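/- Let (M,g) admit a point p with diastasis D^g_p such that e^{D^g_p} ∈ F̃^{γ₁} ⋯ F̃^{γ_r} for some real numbers γ₁,…,γ_r (i.e. e^{D^g_p} is a product of real powers of diastasis-type functions built from Nash algebraic data). Then any Kähler–Ricci soliton (g,X) on M is trivial (g is Kähler–Einstein). -/

import Mathlib

open Complex BigOperators Matrix
open scoped ComplexOrder

/-- Wirtinger derivative `∂f/∂z_α` of a (not necessarily holomorphic) function. -/
noncomputable def wirt {n : ℕ} (α : Fin n) (f : (Fin n → ℂ) → ℂ) (z : Fin n → ℂ) : ℂ :=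
  (fderiv ℝ f z (Pi.single α 1 : Fin n → ℂ)
    - Complex.I * fderiv ℝ f z (Pi.single α Complex.I : Fin n → ℂ)) / 2

/-- Wirtinger derivative `∂f/∂z̄_α`. -/
noncomputable def wirtBar {n : ℕ} (α : Fin n) (f : (Fin n → ℂ) → ℂ) (z : Fin n → ℂ) : ℂ :=
  (fderiv ℝ f z (Pi.single α 1 : Fin n → ℂ)
    + Complex.I * fderiv ℝ f z (Pi.single α Complex.I : Fin n → ℂ)) / 2

/-- A Kähler metric on an open set `U ⊆ ℂⁿ`, given by its matrix of components
`g_{αβ̄}`: smooth, pointwise positive definite Hermitian, and satisfying the Kähler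
symmetry `∂_γ g_{αβ̄} = ∂_α g_{γβ̄}` (closedness of the Kähler form). -/
def KahlerMetricOn {n : ℕ} (U : Set (Fin n → ℂ))
    (g : (Fin n → ℂ) → Matrix (Fin n) (Fin n) ℂ) : Prop :=
  (∀ α β : Fin n, ContDiffOn ℝ (⊤ : ℕ∞) (fun z => g z α β) U) ∧
  (∀ z ∈ U, (g z).PosDef) ∧
  (∀ z ∈ U, ∀ α β γ : Fin n,
    wirt γ (fun w => g w α β) z = wirt α (fun w => g w γ β) z)

/-- Pullback of a Hermitian metric `h` under a holomorphic map `φ`: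
`(φ*h)_{αβ̄} = ∑_{a,b} ∂_α φ_a  ∂_β φ_b ‾  h_{ab̄}(φ(z))`. -/
noncomputable def pullbackMetric {n N : ℕ} (φ : (Fin n → ℂ) → (Fin N → ℂ))
    (h : (Fin N → ℂ) → Matrix (Fin N) (Fin N) ℂ) :
    (Fin n → ℂ) → Matrix (Fin n) (Fin n) ℂ :=
  fun z => Matrix.of fun α β =>
    ∑ a : Fin N, ∑ b : Fin N,
      wirt α (fun w => φ w a) z * starRingEnd ℂ (wirt β (fun w => φ w b) z) * h (φ z) a b

/-- A holomorphic isometry `φ : (U, g) → (Ω, h)`. -/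
def HolIsometryOn {n N : ℕ} (φ : (Fin n → ℂ) → (Fin N → ℂ)) (U : Set (Fin n → ℂ))
    (Ω : Set (Fin N → ℂ)) (g : (Fin n → ℂ) → Matrix (Fin n) (Fin n) ℂ)
    (h : (Fin N → ℂ) → Matrix (Fin N) (Fin N) ℂ) : Prop :=
  AnalyticOn ℂ φ U ∧ Set.MapsTo φ U Ω ∧ ∀ z ∈ U, g z = pullbackMetric φ h z

/-- `(Ω, h)` is a homogeneous Kähler domain: the group of biholomorphic isometries of
`(Ω, h)` acts transitively. -/
def HomogeneousKahler {N : ℕ} (Ω : Set (Fin N → ℂ))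
    (h : (Fin N → ℂ) → Matrix (Fin N) (Fin N) ℂ) : Prop :=
  ∀ p ∈ Ω, ∀ q ∈ Ω, ∃ ψ ψ' : (Fin N → ℂ) → (Fin N → ℂ),
    AnalyticOn ℂ ψ Ω ∧ AnalyticOn ℂ ψ' Ω ∧ Set.MapsTo ψ Ω Ω ∧ Set.MapsTo ψ' Ω Ω ∧
    (∀ z ∈ Ω, ψ' (ψ z) = z) ∧ (∀ z ∈ Ω, ψ (ψ' z) = z) ∧
    (∀ z ∈ Ω, h z = pullbackMetric ψ h z) ∧ ψ p = q

/-- Components `R_{αβ̄} = −∂²(log det g)/∂z_α∂z̄_β` of the Ricci tensor of a Kähler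
metric `g`. -/
noncomputable def ricci {n : ℕ} (g : (Fin n → ℂ) → Matrix (Fin n) (Fin n) ℂ)
    (α β : Fin n) (z : Fin n → ℂ) : ℂ :=
  - wirt α (fun w => wirtBar β (fun u => Complex.log ((g u).det)) w) z

/-- Components of the Lie derivative `L_X g` of a Kähler metric `g` along the real
holomorphic vector field `X = ∑_j f_j ∂_j + f̄_j ∂_j̄`. -/
noncomputable def lieDerivMetric {n : ℕ} (g : (Fin n → ℂ) → Matrix (Fin n) (Fin n) ℂ)
    (f : (Fin n → ℂ) → (Fin n → ℂ)) (α β : Fin n) (z : Fin n → ℂ) : ℂ :=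
  ∑ j : Fin n,
    (f z j * wirt j (fun w => g w α β) z
      + starRingEnd ℂ (f z j) * wirtBar j (fun w => g w α β) z
      + wirt α (fun w => f w j) z * g z j β
      + starRingEnd ℂ (wirt β (fun w => f w j) z) * g z α j)

/-- The componentwise conjugate of a vector. -/
def conjVec {n : ℕ} (w : Fin n → ℂ) : Fin n → ℂ := fun i => starRingEnd ℂ (w i)

/-- A holomorphic function on `V ⊆ (σ → ℂ)` is Nash algebraic if it satisfies a
nontrivial polynomial identity with polynomial coefficients. -/
def NashAlg (σ : Type) [Fintype σ] (V : Set (σ → ℂ)) (ξ : (σ → ℂ) → ℂ) : Prop :=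
  ∃ P : Polynomial (MvPolynomial σ ℂ), P ≠ 0 ∧
    ∀ x ∈ V, Polynomial.eval₂ (MvPolynomial.eval x) (ξ x) P = 0

/-- The class `F`: (polarizations of) real analytic functions of the form
`ξ(f₁,…,f_m)` with `ξ` Nash algebraic in the polarized variables and `f_j`
holomorphic germs at `0 ∈ ℂⁿ`. -/
def InCalabiF {n : ℕ} (D : Set (Fin n → ℂ)) (Ψ : (Fin n → ℂ) × (Fin n → ℂ) → ℂ) : Prop :=
  ∃ (m : ℕ) (V : Set ((Fin m ⊕ Fin m) → ℂ)) (ξ : ((Fin m ⊕ Fin m) → ℂ) → ℂ)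
    (f : (Fin n → ℂ) → Fin m → ℂ),
    IsOpen V ∧ AnalyticOn ℂ ξ V ∧ NashAlg (Fin m ⊕ Fin m) V ξ ∧ AnalyticOn ℂ f D ∧
    (∀ z ∈ D, ∀ w ∈ D,
      Sum.elim (f z) (fun i => starRingEnd ℂ (f (conjVec w) i)) ∈ V ∧
      Ψ (z, w) = ξ (Sum.elim (f z) (fun i => starRingEnd ℂ (f (conjVec w) i)))) ∧
    (∀ z ∈ D, (Ψ (z, conjVec z)).im = 0)

/-- Diastasis-type: no nonconstant purely holomorphic or antiholomorphic terms. -/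
def DiastasisTypeF {n : ℕ} (D : Set (Fin n → ℂ)) (Ψ : (Fin n → ℂ) × (Fin n → ℂ) → ℂ) :
    Prop :=
  (∀ z ∈ D, Ψ (z, 0) = Ψ (0, 0)) ∧ (∀ w ∈ D, Ψ (0, conjVec w) = Ψ (0, 0))

/-- The mixed second derivative `∂²P/∂z_α ∂w̄_β` of a polarized potential. -/
noncomputable def mixedDeriv {n : ℕ} (P : (Fin n → ℂ) × (Fin n → ℂ) → ℂ)
    (α β : Fin n) (x : (Fin n → ℂ) × (Fin n → ℂ)) : ℂ :=
  deriv (fun s : ℂ =>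
    deriv (fun t : ℂ =>
      P (x.1 + s • (Pi.single α 1 : Fin n → ℂ),
         x.2 + t • (Pi.single β 1 : Fin n → ℂ))) 0) 0



section Alg1
open scoped Differential
open Polynomial

/-- Galois averaging. -/
lemma krs_galois {F K : Type*} [Field F] [Field K] [Differential F] [Differential K]
    [Algebra F K] [DifferentialAlgebra F K] [CharZero F] [FiniteDimensional F K]
    [IsGalois F K] (a : F) (ι : Type) [Fintype ι] (c : ι → F)
    (u : ι → K) (hu : ∀ i, u i ≠ 0)
    (h : algebraMap F K a = ∑ x, algebraMap F K (c x) * Differential.logDeriv (u x)) :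
    ∃ (N : ℕ) (u₀ : ι → F), N ≠ 0 ∧ (∀ i, u₀ i ≠ 0) ∧
      (N : F) * a = ∑ x, c x * Differential.logDeriv (u₀ x) := by
  let u₁ (i : ι) := ∏ x : (K ≃ₐ[F] K), x (u i)
  have h1 : ∀ i, u₁ i ∈ IntermediateField.fixedField (⊤ : Subgroup (K ≃ₐ[F] K)) := by
    rintro i ⟨e, _⟩
    change e (u₁ i) = u₁ i
    simp only [u₁, map_prod]
    apply Fintype.prod_equiv (Equiv.mulLeft e)
    simp
  have ffb : IntermediateField.fixedField ⊤ = ⊥ :=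
    (IsGalois.tfae.out 0 1).mp (inferInstance : IsGalois F K)
  simp_rw [ffb, IntermediateField.mem_bot, Set.mem_range] at h1
  choose u₀ hu₀ using h1
  have hinj := FaithfulSMul.algebraMap_injective F K
  refine ⟨Fintype.card (K ≃ₐ[F] K), u₀, Fintype.card_ne_zero, ?_, ?_⟩
  · intro i h0
    have := hu₀ i
    rw [h0, map_zero] at this
    have h2 := (Finset.prod_eq_zero_iff.mp this.symm)
    obtain ⟨e, _, he⟩ := h2
    exact hu i (by simpa using he)
  · apply hinj
    simp only [map_mul, map_sum, map_natCast, ← Differential.logDeriv_algebraMap, hu₀]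
    have h3 : ∀ i, Differential.logDeriv (u₁ i) = ∑ x : K ≃ₐ[F] K, Differential.logDeriv (x (u i)) := by
      intro i
      apply Differential.logDeriv_prod
      intro x _
      simpa using hu i
    simp_rw [h3, Finset.mul_sum]
    rw [Finset.sum_comm]
    trans ∑ _ : (K ≃ₐ[F] K), algebraMap F K a
    · simp
    · refine Finset.sum_congr rfl fun e _ => ?_
      have h' := congrArg e h
      simp only [AlgEquiv.commutes, map_sum, map_mul] at h'
      rw [h']
      refine Finset.sum_congr rfl fun x _ => ?_
      simp [Differential.logDeriv, Differential.algEquiv_deriv']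

lemma krs_finite {F K : Type*} [Field F] [Field K] [Differential F] [Differential K]
    [Algebra F K] [DifferentialAlgebra F K] [CharZero F] [FiniteDimensional F K]
    (a : F) (ι : Type) [Fintype ι] (c : ι → F)
    (u : ι → K) (hu : ∀ i, u i ≠ 0)
    (h : algebraMap F K a = ∑ x, algebraMap F K (c x) * Differential.logDeriv (u x)) :
    ∃ (N : ℕ) (u₀ : ι → F), N ≠ 0 ∧ (∀ i, u₀ i ≠ 0) ∧
      (N : F) * a = ∑ x, c x * Differential.logDeriv (u₀ x) := by
  let K'' := IntermediateField.normalClosure F K (AlgebraicClosure K)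
  letI : Algebra K K'' := normalClosure.algebra F K (AlgebraicClosure K)
  haveI : IsScalarTower F K K'' := inferInstance
  haveI : FiniteDimensional F K'' := inferInstance
  haveI : IsGalois F K'' := ⟨⟩
  letI : Differential K'' := Differential.differentialFiniteDimensional F K''
  haveI : DifferentialAlgebra F K'' := Differential.differentialAlgebraFiniteDimensional
  have key : ∀ y : K, (algebraMap K K'' y)′ = algebraMap K K'' (y′) := by
    intro y
    exact (Differential.algHom_deriv' (IsScalarTower.toAlgHom F K K'')
      (FaithfulSMul.algebraMap_injective K K'') y).symm
  have hinj := FaithfulSMul.algebraMap_injective K K''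
  refine krs_galois (K := K'') a ι c (fun i => algebraMap K K'' (u i)) ?_ ?_
  · intro i
    simpa using hu i
  · rw [IsScalarTower.algebraMap_apply F K K'', h, map_sum]
    refine Finset.sum_congr rfl fun x _ => ?_
    simp [Differential.logDeriv, key, IsScalarTower.algebraMap_apply F K K'']

end Alg1


section Alg2
open scoped Differential
open Polynomial

lemma krs_der_alg {k Λ : Type*} [Field k] [CharZero k] [Field Λ] [Algebra k Λ]
    (δ : Derivation k Λ Λ) (F : Λ) (hF : IsAlgebraic k F) : δ F = 0 := by
  have hi : IsIntegral k F := hF.isIntegral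
  have hs : (minpoly k F).Separable := (minpoly.irreducible hi).separable
  have h1 : aeval F (minpoly k F) = 0 := minpoly.aeval k F
  have h2 := Derivation.map_aeval δ (P := minpoly k F) (x := F)
  rw [h1, map_zero] at h2
  have h3 := hs.aeval_derivative_ne_zero h1
  have h4 := h2.symm
  rw [smul_eq_mul] at h4
  exact (mul_eq_zero.mp h4).resolve_left h3

lemma krs_rat1 {k Λ : Type*} [Field k] [CharZero k] [Field Λ] [Algebra k Λ]
    (δ : Derivation k Λ Λ) (F : Λ) (hF1 : δ F = 1) (htr : Transcendental k F)
    (c : k) (v : Λ) (hv0 : v ≠ 0) (hv : v ∈ IntermediateField.adjoin k {F}) :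
    ∃ a b : k[X], b ≠ 0 ∧ a.degree < b.degree ∧
      algebraMap k Λ c * (δ v / v) = aeval F a / aeval F b := by
  obtain ⟨p, q, rfl⟩ := (IntermediateField.mem_adjoin_simple_iff k v).mp hv
  have hp : aeval F p ≠ 0 := fun h => hv0 (by simp [h])
  have hq : aeval F q ≠ 0 := fun h => hv0 (by simp [h])
  have hp0 : p ≠ 0 := fun h => hp (by simp [h])
  have hq0 : q ≠ 0 := fun h => hq (by simp [h])
  have hd : ∀ r : k[X], δ (aeval F r) = aeval F (derivative r) := fun r => by
    have := Derivation.map_aeval δ (P := r) (x := F)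
    rw [this, hF1, smul_eq_mul, mul_one]
  refine ⟨C c * (derivative p * q - p * derivative q), p * q, mul_ne_zero hp0 hq0, ?_, ?_⟩
  · have h1 : (derivative p * q - p * derivative q).degree < (p * q).degree := by
      refine lt_of_le_of_lt (degree_sub_le _ _) (max_lt ?_ ?_)
      · rw [degree_mul, degree_mul]
        exact WithBot.add_lt_add_right (degree_ne_bot.mpr hq0) (degree_derivative_lt hp0)
      · rw [degree_mul, degree_mul]
        exact WithBot.add_lt_add_left (degree_ne_bot.mpr hp0) (degree_derivative_lt hq0)
    refine lt_of_le_of_lt ?_ h1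
    rw [degree_mul]
    refine (add_le_add_left degree_C_le _).trans ?_
    simp
  · rw [Derivation.leibniz_div, hd, hd]
    simp only [map_mul, map_sub, aeval_C, smul_eq_mul]
    field_simp

lemma krs_rat {k Λ : Type*} [Field k] [CharZero k] [Field Λ] [Algebra k Λ]
    (δ : Derivation k Λ Λ) (F : Λ) (hF1 : δ F = 1) (htr : Transcendental k F)
    (ι : Type) (c : ι → k) (v : ι → Λ) (hv0 : ∀ i, v i ≠ 0)
    (hv : ∀ i, v i ∈ IntermediateField.adjoin k {F}) (s : Finset ι) :
    ∃ a b : k[X], b ≠ 0 ∧ a.degree < b.degree ∧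
      ∑ i ∈ s, algebraMap k Λ (c i) * (δ (v i) / v i) = aeval F a / aeval F b := by
  classical
  have hne : ∀ b : k[X], b ≠ 0 → aeval F b ≠ 0 := fun b hb h =>
    hb ((transcendental_iff.mp htr) b h)
  induction s using Finset.induction_on with
  | empty => exact ⟨0, 1, one_ne_zero, by simp, by simp⟩
  | insert i s hi ih =>
    obtain ⟨a, b, hb, hab, h⟩ := ih
    obtain ⟨a', b', hb', hab', h'⟩ := krs_rat1 δ F hF1 htr (c i) (v i) (hv0 i) (hv i)
    refine ⟨a' * b + b' * a, b' * b, mul_ne_zero hb' hb, ?_, ?_⟩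
    · refine lt_of_le_of_lt (degree_add_le _ _) (max_lt ?_ ?_)
      · rw [degree_mul, degree_mul]
        exact WithBot.add_lt_add_right (degree_ne_bot.mpr hb) hab'
      · rw [degree_mul, degree_mul]
        exact WithBot.add_lt_add_left (degree_ne_bot.mpr hb') hab
    · rw [Finset.sum_insert hi, h, h']
      have := hne b hb
      have := hne b' hb'
      simp only [map_mul, map_add]
      field_simp

lemma krs_core1 {k Λ : Type*} [Field k] [CharZero k] [Field Λ] [Algebra k Λ]
    (δ : Derivation k Λ Λ) (F : Λ) (hF1 : δ F = 1)
    (ι : Type) [Fintype ι] (ν : ι → k) (u : ι → Λ) (hu0 : ∀ i, u i ≠ 0)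
    (hu : ∀ i, IsAlgebraic (IntermediateField.adjoin k {F}) (u i))
    (h : 1 = ∑ i, algebraMap k Λ (ν i) * (δ (u i) / u i)) : False := by
  have htr : Transcendental k F := fun h => by
    rw [krs_der_alg δ F h] at hF1; exact zero_ne_one hF1
  have hst : ∀ x ∈ IntermediateField.adjoin k {F}, δ x ∈ IntermediateField.adjoin k {F} := by
    intro x hx
    induction hx using IntermediateField.adjoin_induction with
    | mem x hx => rw [Set.mem_singleton_iff.mp hx, hF1]; exact one_mem _
    | algebraMap x => rw [Derivation.map_algebraMap]; exact zero_mem _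
    | add x y _ _ h1 h2 => rw [map_add]; exact add_mem h1 h2
    | inv x hx h1 =>
      rw [Derivation.leibniz_inv, smul_eq_mul]
      exact mul_mem (neg_mem (pow_mem (inv_mem hx) _)) h1
    | mul x y hx hy h1 h2 =>
      rw [Derivation.leibniz]; exact add_mem (mul_mem hx h2) (mul_mem hy h1)
  let K := IntermediateField.adjoin k {F}
  letI : Differential Λ := ⟨δ.restrictScalars ℤ⟩
  have hdΛ : ∀ x : Λ, x′ = δ x := fun x => rfl
  letI : Differential K := ⟨Derivation.mk' ((AddMonoidHom.mk'
      (fun x : K => (⟨δ x, hst _ x.2⟩ : K)) (by intro a b; ext; simp)).toIntLinearMap) (by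
        intro a b; ext; simp)⟩
  haveI : DifferentialAlgebra K Λ := ⟨fun a => rfl⟩
  let B : IntermediateField K Λ := IntermediateField.adjoin K (Set.range u)
  haveI : FiniteDimensional K B := IntermediateField.finiteDimensional_adjoin (by
    rintro x ⟨i, rfl⟩; exact (hu i).isIntegral)
  let u' : ι → B := fun i => ⟨u i, IntermediateField.subset_adjoin _ _ ⟨i, rfl⟩⟩
  have hu' : ∀ i, u' i ≠ 0 := fun i hh => hu0 i (congrArg Subtype.val hh)
  obtain ⟨N, v, hN, hv0, hv⟩ := krs_finite (F := K) (K := B) 1 ι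
    (fun i => algebraMap k K (ν i)) u' hu' (by
      apply (algebraMap B Λ).injective
      rw [map_sum]
      simp only [map_mul, map_one]
      rw [h]
      refine Finset.sum_congr rfl fun i _ => ?_
      rw [← Differential.logDeriv_algebraMap]
      rfl)
  have hv2 := congrArg (algebraMap K Λ) hv
  rw [map_sum] at hv2
  simp only [map_mul, map_one, mul_one, ← Differential.logDeriv_algebraMap, map_natCast] at hv2
  obtain ⟨a, b, hb, hab, hs⟩ := krs_rat δ F hF1 htr ι ν (fun i => (v i : Λ))
    (fun i hh => hv0 i (Subtype.ext hh)) (fun i => (v i).2) Finset.univ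
  have h3 : (N : Λ) = aeval F a / aeval F b := by
    rw [← hs, hv2]; rfl
  have hne : aeval F b ≠ 0 := fun h => hb ((transcendental_iff.mp htr) b h)
  rw [eq_div_iff hne] at h3
  have h4 : (N : k[X]) * b - a = 0 := (transcendental_iff.mp htr) _ (by
    rw [map_sub, map_mul, map_natCast, h3, sub_self])
  have h5 : a = (N : k[X]) * b := (sub_eq_zero.mp h4).symm
  rw [h5, degree_mul] at hab
  have : ((N : k[X])).degree = 0 := by
    rw [← C_eq_natCast]; exact degree_C (by exact_mod_cast hN)
  rw [this, zero_add] at hab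
  exact lt_irrefl _ hab

/-- algebraic core -/
lemma krs_core {k Λ : Type*} [Field k] [CharZero k] [Field Λ] [Algebra k Λ]
    (δ : Derivation k Λ Λ) (x F : Λ) (hF : IsAlgebraic (Algebra.adjoin k {x}) F)
    (ι : Type) [Fintype ι] (ν : ι → k) (u : ι → Λ) (hu0 : ∀ i, u i ≠ 0)
    (hu : ∀ i, IsAlgebraic (Algebra.adjoin k {x}) (u i))
    (h : δ F + ∑ i, algebraMap k Λ (ν i) * (δ (u i) / u i) = 0) : δ F = 0 := by
  by_contra hne
  have htr : Transcendental k F := fun h => hne (krs_der_alg δ F h)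
  by_cases hx : IsAlgebraic k x
  · apply htr
    have h1 : Algebra.IsAlgebraic k (Algebra.adjoin k {x}) :=
      (Subalgebra.isAlgebraic_iff _).mp (Algebra.isAlgebraic_adjoin_singleton_iff.mpr hx)
    exact hF.restrictScalars k
  · have hxF : IsAlgebraic (Algebra.adjoin k {F}) x :=
      IsAlgebraic.adjoin_singleton (R := k) (A := Λ) (B := Λ) hx htr hF
    have hu2 : ∀ i, IsAlgebraic (Algebra.adjoin k {F}) (u i) := fun i =>
      IsAlgebraic.adjoin_of_forall_isAlgebraic (by
        rintro y ⟨hy, -⟩; rw [Set.mem_singleton_iff.mp hy]; exact hxF) (hu i)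
    refine krs_core1 ((δ F)⁻¹ • δ) F ?_ ι (fun i => - ν i) u hu0
      (fun i => IntermediateField.isAlgebraic_adjoin_iff.mpr (hu2 i)) ?_
    · simp [hne]
    · have h2 : δ F = - ∑ i, algebraMap k Λ (ν i) * (δ (u i) / u i) := eq_neg_of_add_eq_zero_left h
      calc (1:Λ) = (δ F)⁻¹ * δ F := (inv_mul_cancel₀ hne).symm
        _ = (δ F)⁻¹ * - ∑ i, algebraMap k Λ (ν i) * (δ (u i) / u i) := by rw [← h2]
        _ = _ := by
          rw [← Finset.sum_neg_distrib, Finset.mul_sum]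
          refine Finset.sum_congr rfl fun i _ => ?_
          simp only [Derivation.coe_smul, Pi.smul_apply, smul_eq_mul, map_neg]
          ring
end Alg2


section Alg3
open Polynomial

lemma krs_der_lift {R S T : Type} [CommRing R] [CommRing S] [CommRing T] [Algebra R S]
    [Algebra S T] [Algebra R T] [IsScalarTower R S T] [Algebra.FormallyEtale S T]
    (d : Derivation R S T) : ∃ d' : Derivation R T T, ∀ s, d' (algebraMap S T s) = d s := by
  let l : TensorProduct S T (KaehlerDifferential R S) →ₗ[T] T :=
    LinearMap.liftBaseChange T d.liftKaehlerDifferential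
  let e := KaehlerDifferential.tensorKaehlerEquivOfFormallyEtale R S T
  refine ⟨(l ∘ₗ e.symm.toLinearMap).compDer (KaehlerDifferential.D R T), fun s => ?_⟩
  have := KaehlerDifferential.tensorKaehlerEquivOfFormallyEtale_symm_D_algebraMap R S T s
  change l (e.symm (KaehlerDifferential.D R T (algebraMap S T s))) = d s
  rw [this]
  simp [l]

lemma krs_isAlg_map {R S L L' : Type*} [CommRing R] [CommRing S] [CommRing L] [CommRing L']
    [Algebra R L] [Algebra S L'] (φ : R →+* S) (hφ : Function.Injective φ) (g : L →+* L')
    (hc : ∀ r, algebraMap S L' (φ r) = g (algebraMap R L r)) (y : L) (hy : IsAlgebraic R y) :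
    IsAlgebraic S (g y) := by
  obtain ⟨p, hp, h⟩ := hy
  refine ⟨p.map φ, (Polynomial.map_ne_zero_iff hφ).mpr hp, ?_⟩
  rw [aeval_def, eval₂_map]
  have : (algebraMap S L').comp φ = g.comp (algebraMap R L) := RingHom.ext hc
  rw [this, ← Polynomial.hom_eval₂, ← aeval_def, h, map_zero]

lemma krs_exists_der {M : Type} [Field M] [Algebra ℂ M] (x : M)
    (hx : x ∉ (algebraMap ℂ M).range) :
    ∃ δ : Derivation ℂ M M, δ x = 1 ∧
      ∀ m : M, IsAlgebraic (Algebra.adjoin ℂ ({x} ∪ {c | δ c = 0} : Set M)) m := by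
  classical
  have htr : Transcendental ℂ x := by
    intro h
    apply hx
    exact minpoly.mem_range_of_degree_eq_one ℂ x
      (IsAlgClosed.degree_eq_one_of_irreducible ℂ (minpoly.irreducible h.isIntegral))
  have hind : AlgebraicIndepOn ℂ id ({x} : Set M) :=
    (algebraicIndependent_singleton_iff (⟨x, rfl⟩ : ({x} : Set M))).mpr htr
  obtain ⟨Y, hY, hYb⟩ := exists_isTranscendenceBasis_superset hind
  have hxY : x ∈ Y := hY rfl
  let R := MvPolynomial Y ℂ
  let ev : R →ₐ[ℂ] M := MvPolynomial.aeval (fun y : Y => (y : M))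
  have hinj : Function.Injective ev := hYb.1
  letI : Algebra R M := ev.toRingHom.toAlgebra
  haveI : IsScalarTower ℂ R M := IsScalarTower.of_algebraMap_eq (fun c => (ev.commutes c).symm)
  haveI : FaithfulSMul R M := (faithfulSMul_iff_algebraMap_injective R M).mpr hinj
  have hRalg : Algebra.IsAlgebraic R M := by
    refine ⟨fun m => ?_⟩
    have hm := hYb.isAlgebraic.isAlgebraic m
    refine krs_isAlg_map (L := M) (L' := M) (S := R)
      (hYb.1.aevalEquiv.symm : _ ≃ₐ[ℂ] R).toAlgHom.toRingHom
      hYb.1.aevalEquiv.symm.injective (RingHom.id M) (fun r => ?_) m hm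
    obtain ⟨q, rfl⟩ := hYb.1.aevalEquiv.surjective r
    change ev (hYb.1.aevalEquiv.symm (hYb.1.aevalEquiv q)) = _
    rw [AlgEquiv.symm_apply_apply]
    exact (hYb.1.algebraMap_aevalEquiv q).symm
  letI : Algebra (FractionRing R) M := FractionRing.liftAlgebra R M
  haveI : IsScalarTower R (FractionRing R) M := inferInstance
  haveI : Algebra.IsAlgebraic (FractionRing R) M :=
    (IsFractionRing.comap_isAlgebraic_iff (A := R)).mp hRalg
  haveI : CharZero (FractionRing R) :=
    charZero_of_injective_algebraMap (IsFractionRing.injective R (FractionRing R))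
  haveI : Algebra.FormallyEtale (FractionRing R) M := Algebra.FormallyEtale.of_isSeparable _ _
  haveI : Algebra.FormallyEtale R (FractionRing R) :=
    Algebra.FormallyEtale.of_isLocalization (nonZeroDivisors R)
  haveI : Algebra.FormallyEtale R M := Algebra.FormallyEtale.comp R (FractionRing R) M
  obtain ⟨δ, hδ⟩ := krs_der_lift (R := ℂ) (S := R) (T := M)
    ((Algebra.linearMap R M).compDer (MvPolynomial.pderiv (⟨x, hxY⟩ : Y)))
  have hδY : ∀ y : Y, δ y = if y = ⟨x, hxY⟩ then 1 else 0 := by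
    intro y
    have h1 := hδ (MvPolynomial.X y)
    have h2 : algebraMap R M (MvPolynomial.X y) = y := MvPolynomial.aeval_X _ _
    rw [h2] at h1
    rw [h1]
    change algebraMap R M (MvPolynomial.pderiv (⟨x, hxY⟩ : Y) (MvPolynomial.X y)) = _
    rw [MvPolynomial.pderiv_X, Pi.single_apply]
    simp only [apply_ite (algebraMap R M), map_one, map_zero, eq_comm]
  refine ⟨δ, ?_, ?_⟩
  · have := hδY ⟨x, hxY⟩
    simpa using this
  · intro m
    have hm := hRalg.isAlgebraic m
    have hmem : ∀ r : R, algebraMap R M r ∈ Algebra.adjoin ℂ ({x} ∪ {c | δ c = 0} : Set M) := by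
      intro r
      change ev r ∈ _
      induction r using MvPolynomial.induction_on with
      | C a => rw [MvPolynomial.algHom_C]; exact Subalgebra.algebraMap_mem _ _
      | add p q hp hq => rw [map_add]; exact add_mem hp hq
      | mul_X p y hp =>
        rw [map_mul]
        refine mul_mem hp (Algebra.subset_adjoin ?_)
        by_cases hy : y = ⟨x, hxY⟩
        · left; rw [hy]; exact MvPolynomial.aeval_X _ _
        · right; change δ (MvPolynomial.aeval _ (MvPolynomial.X y)) = 0; rw [MvPolynomial.aeval_X, hδY, if_neg hy]
    refine krs_isAlg_map (R := R) (L := M) (L' := M)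
      ((algebraMap R M).codRestrict (Algebra.adjoin ℂ ({x} ∪ {c | δ c = 0} : Set M)) hmem)
      ?_ (RingHom.id M) (fun r => rfl) m hm
    intro a b hab
    exact hinj (congrArg Subtype.val hab)
end Alg3


section Alg4

/-- coefficientwise extension of a derivation to power series -/
noncomputable def krsPsDer {M : Type} [Field M] [Algebra ℂ M] (δ : Derivation ℂ M M) :
    Derivation ℂ (PowerSeries M) (PowerSeries M) :=
  Derivation.mk' { toFun := fun f => PowerSeries.mk fun n => δ (PowerSeries.coeff n f)
                   map_add' := by intro f g; ext n; simp
                   map_smul' := by intro c f; ext n; simp } (by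
    intro f g
    ext n
    simp only [LinearMap.coe_mk, AddHom.coe_mk, PowerSeries.coeff_mk, PowerSeries.coeff_mul,
      map_sum, Derivation.leibniz, map_add, smul_eq_mul, Finset.sum_add_distrib]
    congr 1
    exact Finset.sum_nbij' Prod.swap Prod.swap (by simp [add_comm]) (by simp [add_comm])
      (by simp) (by simp) (by simp))

lemma krsPsDer_coeff {M : Type} [Field M] [Algebra ℂ M] (δ : Derivation ℂ M M)
    (f : PowerSeries M) (n : ℕ) :
    PowerSeries.coeff n (krsPsDer δ f) = δ (PowerSeries.coeff n f) := by
  change PowerSeries.coeff n (PowerSeries.mk fun n => δ (PowerSeries.coeff n f)) = _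
  simp

lemma krsPsDer_C {M : Type} [Field M] [Algebra ℂ M] (δ : Derivation ℂ M M) (m : M) :
    krsPsDer δ (PowerSeries.C m) = PowerSeries.C (δ m) := by
  ext n
  rw [krsPsDer_coeff, PowerSeries.coeff_C, PowerSeries.coeff_C]
  split_ifs <;> simp

lemma krsPsDer_comm {M : Type} [Field M] [Algebra ℂ M] (δ : Derivation ℂ M M)
    (f : PowerSeries M) :
    krsPsDer δ (PowerSeries.derivative M f) = PowerSeries.derivative M (krsPsDer δ f) := by
  ext n
  rw [krsPsDer_coeff, PowerSeries.coeff_derivative, PowerSeries.coeff_derivative, krsPsDer_coeff,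
    Derivation.leibniz]
  have : δ ((n : M) + 1) = 0 := by simp
  rw [this]; simp [mul_comm]

lemma krsPsDer_map {M : Type} [Field M] [Algebra ℂ M] (δ : Derivation ℂ M M)
    (f : PowerSeries ℂ) : krsPsDer δ (PowerSeries.map (algebraMap ℂ M) f) = 0 := by
  ext n
  rw [krsPsDer_coeff]
  simp

/-- field of constants -/
def krsConst {Λ : Type} [Field Λ] [Algebra ℂ Λ] (δ : Derivation ℂ Λ Λ) :
    IntermediateField ℂ Λ where
  carrier := {c | δ c = 0}
  mul_mem' := by intro a b ha hb; simp only [Set.mem_setOf_eq] at *; simp [ha, hb]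
  add_mem' := by intro a b ha hb; simp only [Set.mem_setOf_eq] at *; simp [ha, hb]
  algebraMap_mem' := by intro r; simp
  inv_mem' := by intro a ha; simp only [Set.mem_setOf_eq] at *; simp [ha, Derivation.leibniz_inv]

/-- a derivation is linear over its constants -/
noncomputable def krsConstDer {Λ : Type} [Field Λ] [Algebra ℂ Λ] (δ : Derivation ℂ Λ Λ) :
    Derivation (krsConst δ) Λ Λ :=
  Derivation.mk' { toFun := δ
                   map_add' := map_add δ
                   map_smul' := by
                    rintro ⟨c, hc⟩ x
                    have hc' : δ c = 0 := hc
                    change δ (c * x) = c * δ x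
                    simp [hc'] } (fun a b => δ.leibniz a b)

lemma krs_logcomm {R : Type} [CommRing R] (D E : R → R)
    (hD : ∀ a b, D (a * b) = a * D b + b * D a) (hE : ∀ a b, E (a * b) = a * E b + b * E a)
    (hDi : ∀ a b, a * b = 1 → D b = - b ^ 2 * D a) (hEi : ∀ a b, a * b = 1 → E b = - b ^ 2 * E a)
    (hc : ∀ a, D (E a) = E (D a)) (a b : R) (hab : a * b = 1) :
    D (E a * b) = E (D a * b) := by
  rw [hD, hE, hDi a b hab, hEi a b hab, hc]; ring

lemma krs_formal {M : Type} [Field M] [Algebra ℂ M] (F : PowerSeries M) (ι : Type) [Fintype ι]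
    (χ : ι → PowerSeries M) (hχ : ∀ i, PowerSeries.constantCoeff (χ i) ≠ 0) (ν : ι → ℂ)
    (ω : PowerSeries ℂ)
    (hω : PowerSeries.derivative M F + ∑ i, algebraMap ℂ (PowerSeries M) (ν i) *
      (PowerSeries.derivative M (χ i) * (χ i)⁻¹) = PowerSeries.map (algebraMap ℂ M) ω)
    (hE : ∀ E : Subfield (FractionRing (PowerSeries M)),
      (∀ m : M, algebraMap (PowerSeries M) (FractionRing (PowerSeries M)) (PowerSeries.C m) ∈ E) →
      (∀ f : PowerSeries ℂ, algebraMap (PowerSeries M) (FractionRing (PowerSeries M))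
        (PowerSeries.map (algebraMap ℂ M) f) ∈ E) →
      (∀ y, IsAlgebraic E y → y ∈ E) →
      algebraMap (PowerSeries M) (FractionRing (PowerSeries M)) F ∈ E ∧
      ∀ i, algebraMap (PowerSeries M) (FractionRing (PowerSeries M)) (χ i) ∈ E)
    (j : ℕ) (hj : j ≠ 0) : PowerSeries.coeff j F ∈ (algebraMap ℂ M).range := by
  by_contra hx
  obtain ⟨δ, hδx, hδalg⟩ := krs_exists_der _ hx
  set x := PowerSeries.coeff j F with hxdef
  let Λ := FractionRing (PowerSeries M)
  let em : PowerSeries M →+* Λ := algebraMap _ _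
  have hem : Function.Injective em := IsFractionRing.injective _ _
  have hDi : ∀ (D : Derivation ℂ (PowerSeries M) (PowerSeries M)) a b, a * b = 1 →
      D b = - b ^ 2 * D a := fun D a b h => by
    have := D.leibniz_of_mul_eq_one (a := b) (b := a) (by rw [mul_comm]; exact h)
    simpa using this
  haveI : CharZero M := charZero_of_injective_algebraMap (algebraMap ℂ M).injective
  have hinv : ∀ i, χ i * (χ i)⁻¹ = 1 := fun i => PowerSeries.mul_inv_cancel _ (hχ i)
  have hinv0 : ∀ i, PowerSeries.C (PowerSeries.constantCoeff (χ i)) *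
      PowerSeries.C (PowerSeries.constantCoeff (χ i))⁻¹ = 1 := fun i => by
    rw [← map_mul, mul_inv_cancel₀ (hχ i), map_one]
  have hW : PowerSeries.derivative M (krsPsDer δ F + ∑ i, algebraMap ℂ (PowerSeries M) (ν i) *
      (krsPsDer δ (χ i) * (χ i)⁻¹)) = 0 := by
    have h1 := congrArg (krsPsDer δ) hω
    rw [krsPsDer_map, map_add, map_sum, krsPsDer_comm] at h1
    rw [map_add, map_sum, ← h1]
    congr 1
    refine Finset.sum_congr rfl fun i _ => ?_
    have key := krs_logcomm (krsPsDer δ) ((PowerSeries.derivative M).restrictScalars ℂ)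
      (fun a b => by simp) (fun a b => by simp) (hDi _) (hDi _) (krsPsDer_comm δ) (χ i) _ (hinv i)
    have e2 : PowerSeries.derivative M (algebraMap ℂ (PowerSeries M) (ν i)) = 0 :=
      ((PowerSeries.derivative M).restrictScalars ℂ).map_algebraMap (ν i)
    rw [(PowerSeries.derivative M).leibniz (algebraMap ℂ (PowerSeries M) (ν i)),
      (krsPsDer δ).leibniz (algebraMap ℂ (PowerSeries M) (ν i)), Derivation.map_algebraMap, e2]
    simp only [smul_zero, add_zero]
    rw [smul_eq_mul, smul_eq_mul]
    congr 1
    exact key.symm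
  have hW2 : krsPsDer δ F + ∑ i, algebraMap ℂ (PowerSeries M) (ν i) *
      (krsPsDer δ (χ i) * (χ i)⁻¹) = PowerSeries.C (δ (PowerSeries.constantCoeff F) + ∑ i,
      algebraMap ℂ M (ν i) * (δ (PowerSeries.constantCoeff (χ i)) *
        (PowerSeries.constantCoeff (χ i))⁻¹)) := by
    have hc0 : ∀ f, PowerSeries.constantCoeff (krsPsDer δ f) = δ (PowerSeries.constantCoeff f) :=
      fun f => by
        rw [← PowerSeries.coeff_zero_eq_constantCoeff_apply, krsPsDer_coeff,
          PowerSeries.coeff_zero_eq_constantCoeff_apply]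
    apply PowerSeries.derivative.ext
    · rw [hW]; simp
    · simp [hc0, PowerSeries.algebraMap_apply]
  haveI : Algebra.FormallyEtale (PowerSeries M) Λ :=
    Algebra.FormallyEtale.of_isLocalization (nonZeroDivisors (PowerSeries M))
  obtain ⟨Δ, hΔ⟩ := krs_der_lift (R := ℂ) (S := PowerSeries M) (T := Λ)
    ((Algebra.linearMap (PowerSeries M) Λ).compDer (krsPsDer δ))
  have hΔ' : ∀ f, Δ (em f) = em (krsPsDer δ f) := hΔ
  let K := IntermediateField.adjoin (krsConst Δ) {em (PowerSeries.C x)}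
  let E := (algebraicClosure K Λ).toSubfield
  have hKE : ∀ y ∈ K, y ∈ E := fun y hy => (algebraicClosure K Λ).algebraMap_mem ⟨y, hy⟩
  have hkK : ∀ y, Δ y = 0 → y ∈ K := fun y hy => K.algebraMap_mem ⟨y, hy⟩
  have hmemE : ∀ y, y ∈ E ↔ IsAlgebraic K y := fun y => mem_algebraicClosure_iff
  have hEM : ∀ m : M, em (PowerSeries.C m) ∈ E := by
    intro m
    rw [hmemE]
    have hmem : ∀ r : Algebra.adjoin ℂ ({x} ∪ {c | δ c = 0} : Set M),
        em (PowerSeries.C (r : M)) ∈ K := by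
      rintro ⟨r, hr⟩
      change em (PowerSeries.C r) ∈ K
      induction hr using Algebra.adjoin_induction with
      | mem y hy =>
        rcases hy with hy | hy
        · rw [Set.mem_singleton_iff.mp hy]
          exact IntermediateField.subset_adjoin _ _ rfl
        · apply hkK
          rw [hΔ', krsPsDer_C, show δ y = 0 from hy]; simp
      | algebraMap r => apply hkK; rw [hΔ', krsPsDer_C]; simp
      | add a b _ _ ha hb => rw [map_add, map_add]; exact add_mem ha hb
      | mul a b _ _ ha hb => rw [map_mul, map_mul]; exact mul_mem ha hb
    refine krs_isAlg_map (L := M) (L' := Λ) (S := K)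
      (((em.comp PowerSeries.C).comp (Algebra.adjoin ℂ ({x} ∪ {c | δ c = 0} : Set M)).val.toRingHom).codRestrict
        K hmem) ?_ (em.comp PowerSeries.C) (fun r => rfl) m (hδalg m)
    intro a b hab
    have := congrArg Subtype.val hab
    exact Subtype.ext (PowerSeries.C_injective (hem this))
  obtain ⟨hFE, hχE⟩ := hE E hEM
    (fun f => hKE _ (hkK _ (by
      change Δ (em _) = 0
      rw [hΔ', krsPsDer_map, map_zero])))
    (fun y hy => by
      rw [hmemE]
      have h2 : IsAlgebraic (algebraicClosure K Λ) y := hy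
      exact h2.restrictScalars K)
  have hFE' : em (F - PowerSeries.C (PowerSeries.constantCoeff F)) ∈ E := by
    rw [map_sub]; exact sub_mem hFE (hEM _)
  have hcore := krs_core (krsConstDer Δ) (em (PowerSeries.C x))
    (em (F - PowerSeries.C (PowerSeries.constantCoeff F)))
    (IntermediateField.isAlgebraic_adjoin_iff.mp ((hmemE _).mp hFE')) (ι ⊕ ι)
    (Sum.elim (fun i => algebraMap ℂ (krsConst Δ) (ν i)) (fun i => - algebraMap ℂ (krsConst Δ) (ν i)))
    (Sum.elim (fun i => em (χ i)) (fun i => em (PowerSeries.C (PowerSeries.constantCoeff (χ i)))))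
    (by
      rintro (i | i)
      · exact fun h => hχ i (by
          have : χ i = 0 := hem (by simpa using h)
          rw [this]; simp)
      · exact fun h => hχ i (by
          have : PowerSeries.C (PowerSeries.constantCoeff (χ i)) = 0 := hem (by simpa using h)
          exact PowerSeries.C_injective (by simpa using this)))
    (by
      rintro (i | i)
      · exact IntermediateField.isAlgebraic_adjoin_iff.mp ((hmemE _).mp (hχE i))
      · exact IntermediateField.isAlgebraic_adjoin_iff.mp ((hmemE _).mp (hEM _)))
    (by
      have hdd : ∀ y, krsConstDer Δ y = Δ y := fun y => rfl
      have hdiv : ∀ a b c : PowerSeries M, a * b = 1 → em c / em a = em (c * b) := by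
        intro a b c hab
        have h1 : em a * em b = 1 := by rw [← map_mul, hab, map_one]
        rw [div_eq_iff (left_ne_zero_of_mul_eq_one h1), ← map_mul]
        congr 1
        rw [mul_assoc, mul_comm b a, hab, mul_one]
      have hcm : ∀ i, algebraMap (krsConst Δ) Λ (algebraMap ℂ (krsConst Δ) (ν i)) = em (algebraMap ℂ _ (ν i)) := by
        intro i
        rw [← IsScalarTower.algebraMap_apply, IsScalarTower.algebraMap_apply ℂ (PowerSeries M) Λ]
      rw [Fintype.sum_sum_type]
      simp only [Sum.elim_inl, Sum.elim_inr, hdd, hΔ', map_neg, hcm]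
      simp only [hdiv _ _ _ (hinv _), hdiv _ _ _ (hinv0 _), ← map_neg, ← map_mul, ← map_sum,
        ← map_add]
      rw [← map_zero em]
      congr 1
      rw [map_sub, krsPsDer_C]
      have h3 := hW2
      simp only [map_add, map_sum, map_mul] at h3
      simp only [krsPsDer_C, map_neg, neg_mul, Finset.sum_neg_distrib]
      have h4 : ∀ i, PowerSeries.C (algebraMap ℂ M (ν i)) = algebraMap ℂ (PowerSeries M) (ν i) :=
        fun i => by rw [PowerSeries.algebraMap_apply]
      simp only [h4] at h3
      linear_combination h3)
  have h5 : em (krsPsDer δ (F - PowerSeries.C (PowerSeries.constantCoeff F))) = 0 := by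
    rw [← hΔ']; exact hcore
  have h6 : krsPsDer δ (F - PowerSeries.C (PowerSeries.constantCoeff F)) = 0 :=
    hem (by rw [h5, map_zero])
  have h7 := congrArg (PowerSeries.coeff j) h6
  rw [krsPsDer_coeff, map_sub, PowerSeries.coeff_C, if_neg hj, sub_zero, ← hxdef, hδx] at h7
  simp at h7
end Alg4


section Alg5

lemma krs_lemmaC {E B : Type} [Field E] [Field B] [Algebra E B] (G : PowerSeries B)
    (Q : Polynomial (PowerSeries E)) (hQ : Q ≠ 0)
    (h : Polynomial.eval₂ (PowerSeries.map (algebraMap E B)) G Q = 0) :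
    IsAlgebraic E (PowerSeries.constantCoeff G) := by
  have hirr : Irreducible (Polynomial.C (PowerSeries.X : PowerSeries E)) :=
    (Polynomial.prime_C_iff.mpr PowerSeries.X_prime).irreducible
  obtain ⟨n, Q', hd, rfl⟩ := WfDvdMonoid.max_power_factor hQ hirr
  have h1 : Polynomial.eval₂ (PowerSeries.map (algebraMap E B)) G Q' = 0 := by
    rw [Polynomial.eval₂_mul, Polynomial.eval₂_pow, Polynomial.eval₂_C, PowerSeries.map_X] at h
    exact (mul_eq_zero.mp h).resolve_left (pow_ne_zero _ PowerSeries.X_ne_zero)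
  refine ⟨Q'.map PowerSeries.constantCoeff, fun h0 => hd ?_, ?_⟩
  · rw [Polynomial.C_dvd_iff_dvd_coeff]
    intro i
    rw [PowerSeries.X_dvd_iff]
    have := congrArg (fun p => Polynomial.coeff p i) h0
    simpa using this
  · rw [Polynomial.aeval_def, Polynomial.eval₂_map]
    have h2 := congrArg (PowerSeries.constantCoeff (R := B)) h1
    rw [Polynomial.hom_eval₂, map_zero] at h2
    rw [← h2]
    congr 1

/-- Taylor series along a derivation -/
noncomputable def krsTay {A : Type} [CommRing A] [Algebra ℂ A] (D : Derivation ℂ A A) (a : A) :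
    PowerSeries A := PowerSeries.mk fun j => ((j.factorial : ℂ)⁻¹) • (D^[j] a)

lemma krsTay_coeff {A : Type} [CommRing A] [Algebra ℂ A] (D : Derivation ℂ A A) (a : A) (n : ℕ) :
    PowerSeries.coeff n (krsTay D a) = ((n.factorial : ℂ)⁻¹) • (D^[n] a) := by
  simp [krsTay]

lemma krs_iter_add {A : Type} [CommRing A] [Algebra ℂ A] (D : Derivation ℂ A A) (n : ℕ)
    (a b : A) : D^[n] (a + b) = D^[n] a + D^[n] b := by
  induction n generalizing a b with
  | zero => rfl
  | succ n ih => simp [Function.iterate_succ_apply, ih]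

lemma krs_iter_zero {A : Type} [CommRing A] [Algebra ℂ A] (D : Derivation ℂ A A) (n : ℕ) :
    D^[n] (0 : A) = 0 := by
  induction n with
  | zero => rfl
  | succ n ih => simp [Function.iterate_succ_apply, ih]

lemma krsTay_derivative {A : Type} [CommRing A] [Algebra ℂ A] (D : Derivation ℂ A A) (a : A) :
    PowerSeries.derivative A (krsTay D a) = krsTay D (D a) := by
  ext n
  rw [PowerSeries.coeff_derivative, krsTay_coeff, krsTay_coeff, Function.iterate_succ_apply]
  have h : ((n : A) + 1) = algebraMap ℂ A ((n : ℂ) + 1) := by simp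
  rw [h, mul_comm, ← Algebra.smul_def, smul_smul]
  congr 1
  have : (n.factorial : ℂ) ≠ 0 := by exact_mod_cast n.factorial_ne_zero
  have h2 : ((n : ℂ) + 1) ≠ 0 := by exact_mod_cast n.succ_ne_zero
  rw [Nat.factorial_succ]
  push_cast
  field_simp

lemma krsTay_add {A : Type} [CommRing A] [Algebra ℂ A] (D : Derivation ℂ A A) (a b : A) :
    krsTay D (a + b) = krsTay D a + krsTay D b := by
  ext n
  rw [map_add, krsTay_coeff, krsTay_coeff, krsTay_coeff, krs_iter_add, smul_add]

lemma krsTay_const {A : Type} [CommRing A] [Algebra ℂ A] (D : Derivation ℂ A A) (a : A)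
    (h : D a = 0) : krsTay D a = PowerSeries.C a := by
  ext n
  rw [krsTay_coeff, PowerSeries.coeff_C]
  cases n with
  | zero => simp
  | succ n => simp [Function.iterate_succ_apply, h, krs_iter_zero]

lemma krsTay_mul {A : Type} [CommRing A] [Algebra ℂ A] (D : Derivation ℂ A A) (a b : A) :
    krsTay D (a * b) = krsTay D a * krsTay D b := by
  ext n
  induction n generalizing a b with
  | zero => simp [krsTay_coeff, PowerSeries.coeff_mul]
  | succ n ih =>
    have key : PowerSeries.coeff n (PowerSeries.derivative A (krsTay D (a * b))) =
        PowerSeries.coeff n (PowerSeries.derivative A (krsTay D a * krsTay D b)) := by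
      rw [krsTay_derivative, Derivation.leibniz, Derivation.leibniz, krsTay_derivative,
        krsTay_derivative, krsTay_add]
      simp only [smul_eq_mul, map_add, ih]
    rw [PowerSeries.coeff_derivative, PowerSeries.coeff_derivative] at key
    have h : ((n : A) + 1) = algebraMap ℂ A ((n : ℂ) + 1) := by simp
    have h2 : ((n : ℂ) + 1) ≠ 0 := by exact_mod_cast n.succ_ne_zero
    have hu : IsUnit ((n : A) + 1) := by
      rw [h]; exact (IsUnit.mk0 _ h2).map _
    exact hu.mul_right_cancel key

/-- Taylor hom -/
noncomputable def krsTayHom {A : Type} [CommRing A] [Algebra ℂ A] (D : Derivation ℂ A A) :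
    A →+* PowerSeries A where
  toFun := krsTay D
  map_one' := by rw [krsTay_const D 1 (by simp), map_one]
  map_mul' := krsTay_mul D
  map_zero' := by rw [krsTay_const D 0 (by simp), map_zero]
  map_add' := krsTay_add D

lemma krs_alg_der {R A : Type} [CommRing R] [IsDomain R] [CharZero R] [CommRing A] [IsDomain A]
    [Algebra R A] [FaithfulSMul R A] [Algebra ℂ A] (D : Derivation ℂ A A)
    (hD : ∀ r : R, IsAlgebraic R (D (algebraMap R A r))) (y : A) (hy : IsAlgebraic R y) :
    IsAlgebraic R (D y) := by
  classical
  have hyp : ∃ n, ∃ P : Polynomial R, P ≠ 0 ∧ Polynomial.aeval y P = 0 ∧ P.natDegree = n := by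
    obtain ⟨P, h1, h2⟩ := hy
    exact ⟨_, P, h1, h2, rfl⟩
  obtain ⟨P, hP, hPy, hPn⟩ := Nat.find_spec hyp
  have hpos : 0 < P.natDegree := by
    by_contra h0
    have h0' : P.natDegree = 0 := by omega
    rw [Polynomial.eq_C_of_natDegree_eq_zero h0', Polynomial.aeval_C] at hPy
    have := (FaithfulSMul.algebraMap_injective R A) (hPy.trans (map_zero _).symm)
    apply hP
    rw [Polynomial.eq_C_of_natDegree_eq_zero h0', this, map_zero]
  have hd0 : Polynomial.derivative P ≠ 0 := fun h => by
    have := Polynomial.natDegree_eq_zero_of_derivative_eq_zero h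
    omega
  have hdy : Polynomial.aeval y (Polynomial.derivative P) ≠ 0 := fun h => by
    have h1 := Polynomial.natDegree_derivative_lt (p := P) (by omega)
    rw [hPn] at h1
    exact Nat.find_min hyp h1 ⟨_, hd0, h, rfl⟩
  have key : ∀ P : Polynomial R, ∃ q : A, IsAlgebraic R q ∧
      D (Polynomial.aeval y P) = q + Polynomial.aeval y (Polynomial.derivative P) * D y := by
    intro P
    induction P using Polynomial.induction_on' with
    | add p q hp hq =>
      obtain ⟨a, ha, ha'⟩ := hp
      obtain ⟨b, hb, hb'⟩ := hq
      exact ⟨a + b, ha.add hb, by simp only [map_add, ha', hb']; ring⟩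
    | monomial n r =>
      refine ⟨D (algebraMap R A r) * y ^ n, (hD r).mul (hy.pow n), ?_⟩
      rw [Polynomial.aeval_monomial, Derivation.leibniz, Derivation.leibniz_pow,
        Polynomial.derivative_monomial, Polynomial.aeval_monomial]
      simp only [smul_eq_mul, nsmul_eq_mul, map_mul, map_natCast]
      ring
  obtain ⟨q, hq, hq'⟩ := key P
  rw [hPy, map_zero] at hq'
  have h3 : Polynomial.aeval y (Polynomial.derivative P) * D y = - q := by
    linear_combination -hq'
  have hy2 : IsAlgebraic R (Polynomial.aeval y (Polynomial.derivative P)) := by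
    rw [Polynomial.aeval_eq_sum_range]
    change _ ∈ Subalgebra.algebraicClosure R A
    refine sum_mem fun i _ => ?_
    change IsAlgebraic R _
    rw [Algebra.smul_def]
    exact (isAlgebraic_algebraMap _).mul (hy.pow i)
  exact IsAlgebraic.of_mul (mem_nonZeroDivisors_of_ne_zero hdy) hy2 (h3 ▸ hq.neg)

end Alg5


section Alg6

/-- field of fractions of one-variable power series -/
abbrev KrsM : Type := FractionRing (PowerSeries ℂ)
/-- field of fractions of power series over `KrsM` -/
abbrev KrsL : Type := FractionRing (PowerSeries KrsM)

/-- the iterated power series ring inside `KrsM[[t]]` -/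
noncomputable def krsJ : PowerSeries (PowerSeries ℂ) →+* PowerSeries KrsM :=
  PowerSeries.map (algebraMap (PowerSeries ℂ) KrsM)

/-- embedding into the big field -/
noncomputable def krsEmb : PowerSeries KrsM →+* KrsL := algebraMap _ _

lemma krsJ_inj : Function.Injective krsJ :=
  PowerSeries.map_injective _ (IsFractionRing.injective _ _)

lemma krsEmb_inj : Function.Injective krsEmb := IsFractionRing.injective _ _

/-- admissible subfields -/
structure KrsE (E : Subfield KrsL) : Prop where
  hM : ∀ m : KrsM, krsEmb (PowerSeries.C m) ∈ E
  hC : ∀ f : PowerSeries ℂ, krsEmb (PowerSeries.map (algebraMap ℂ KrsM) f) ∈ E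
  halg : ∀ y, IsAlgebraic E y → y ∈ E

variable {A : Type} [CommRing A] [Algebra ℂ A] (d dbar : Derivation ℂ A A) (ev : A →ₐ[ℂ] ℂ)

/-- Taylor expansion in the first direction -/
noncomputable def krsEs : A →+* PowerSeries ℂ :=
  (PowerSeries.map (ev : A →+* ℂ)).comp (krsTayHom d)

/-- Taylor expansion in both directions -/
noncomputable def krsTau : A →+* PowerSeries (PowerSeries ℂ) :=
  (PowerSeries.map (krsEs d ev)).comp (krsTayHom dbar)

/-- Taylor expansion into the big field -/
noncomputable def krsT : A →+* KrsL := krsEmb.comp (krsJ.comp (krsTau d dbar ev))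

lemma krs_derivative_map {R S : Type} [CommRing R] [CommRing S] (φ : R →+* S)
    (f : PowerSeries R) :
    PowerSeries.derivative S (PowerSeries.map φ f) =
      PowerSeries.map φ (PowerSeries.derivative R f) := by
  ext n
  simp [PowerSeries.coeff_derivative]

lemma krsTau_dbar (a : A) : PowerSeries.derivative _ (krsJ (krsTau d dbar ev a)) =
    krsJ (krsTau d dbar ev (dbar a)) := by
  rw [krsJ, krs_derivative_map, krsTau, RingHom.comp_apply, krs_derivative_map]
  have h : PowerSeries.derivative A (krsTayHom dbar a) = krsTayHom dbar (dbar a) :=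
    krsTay_derivative dbar a
  rw [h, RingHom.comp_apply]

lemma krsEs_coeff (a : A) (n : ℕ) :
    PowerSeries.coeff n (krsEs d ev a) = ((n.factorial : ℂ)⁻¹) * ev (d^[n] a) := by
  rw [krsEs, RingHom.comp_apply, PowerSeries.coeff_map]
  change ev (PowerSeries.coeff n (krsTay d a)) = _
  rw [krsTay_coeff, map_smul, smul_eq_mul]

lemma krsTau_coeff (a : A) (n : ℕ) :
    PowerSeries.coeff n (krsTau d dbar ev a) = krsEs d ev (((n.factorial : ℂ)⁻¹) • (dbar^[n] a)) := by
  rw [krsTau, RingHom.comp_apply, PowerSeries.coeff_map]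
  congr 1
  exact krsTay_coeff dbar a n

lemma krs_iter_comm (hc : ∀ a, d (dbar a) = dbar (d a)) (a : A) (ha : d a = 0) (n : ℕ) :
    d (dbar^[n] a) = 0 := by
  induction n with
  | zero => exact ha
  | succ n ih => rw [Function.iterate_succ_apply', hc, ih, map_zero]

lemma krsTau_anti (hc : ∀ a, d (dbar a) = dbar (d a)) (a : A) (ha : d a = 0) :
    krsJ (krsTau d dbar ev a) = PowerSeries.map (algebraMap ℂ KrsM)
      (PowerSeries.mk fun n => ev (((n.factorial : ℂ)⁻¹) • (dbar^[n] a))) := by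
  ext n
  rw [krsJ, PowerSeries.coeff_map, krsTau_coeff, PowerSeries.coeff_map, PowerSeries.coeff_mk,
    IsScalarTower.algebraMap_apply ℂ (PowerSeries ℂ) KrsM]
  congr 1
  rw [krsEs, RingHom.comp_apply]
  change PowerSeries.map _ (krsTay d _) = _
  rw [krsTay_const, PowerSeries.map_C, PowerSeries.algebraMap_apply]
  · simp
  · rw [Derivation.map_smul, krs_iter_comm d dbar hc a ha, smul_zero]

lemma krsT_anti (hc : ∀ a, d (dbar a) = dbar (d a)) (a : A) (ha : d a = 0) (E : Subfield KrsL)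
    (hE : KrsE E) : krsT d dbar ev a ∈ E := by
  rw [krsT, RingHom.comp_apply, RingHom.comp_apply, krsTau_anti d dbar ev hc a ha]
  exact hE.hC _

lemma krsT_hol (a : A) (ha : dbar a = 0) (E : Subfield KrsL)
    (hE : KrsE E) : krsT d dbar ev a ∈ E := by
  rw [krsT, RingHom.comp_apply, RingHom.comp_apply, krsTau, RingHom.comp_apply]
  change krsEmb (krsJ (PowerSeries.map _ (krsTay dbar a))) ∈ E
  rw [krsTay_const dbar a ha, PowerSeries.map_C, krsJ, PowerSeries.map_C]
  exact hE.hM _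

lemma krs_abs (hc : ∀ a, d (dbar a) = dbar (d a)) (G : A) (ι : Type) [Fintype ι]
    (c c' : ι → A) (hcc : ∀ i, c i * c' i = 1) (ν : ι → ℂ)
    (hd : d (dbar G + ∑ i, algebraMap ℂ A (ν i) * (dbar (c i) * c' i)) = 0)
    (hE : ∀ E, KrsE E → krsT d dbar ev G ∈ E ∧ ∀ i, krsT d dbar ev (c i) ∈ E) :
    ev (d (dbar G)) = 0 := by
  let t : A →+* PowerSeries KrsM := krsJ.comp (krsTau d dbar ev)
  have htinv : ∀ i, PowerSeries.constantCoeff (t (c i)) ≠ 0 := fun i => by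
    have h1 : PowerSeries.constantCoeff (t (c i)) * PowerSeries.constantCoeff (t (c' i)) = 1 := by
      rw [← map_mul, ← map_mul, hcc, map_one, map_one]
    exact left_ne_zero_of_mul_eq_one h1
  have htinv2 : ∀ i, (t (c i))⁻¹ = t (c' i) := fun i => by
    rw [eq_comm, PowerSeries.eq_inv_iff_mul_eq_one (htinv i), ← map_mul, mul_comm, hcc, map_one]
  have htd : ∀ a, PowerSeries.derivative _ (t a) = t (dbar a) := krsTau_dbar d dbar ev
  have htc : ∀ z : ℂ, t (algebraMap ℂ A z) = algebraMap ℂ (PowerSeries KrsM) z := fun z => by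
    change krsJ (PowerSeries.map _ (krsTay dbar _)) = _
    rw [krsTay_const dbar _ (by simp), PowerSeries.map_C, krsJ, PowerSeries.map_C, krsEs,
      RingHom.comp_apply]
    change PowerSeries.C (algebraMap _ _ (PowerSeries.map _ (krsTay d _))) = _
    rw [krsTay_const d _ (by simp), PowerSeries.map_C, PowerSeries.algebraMap_apply,
      IsScalarTower.algebraMap_apply ℂ (PowerSeries ℂ) KrsM, PowerSeries.algebraMap_apply]
    simp
  have key := krs_formal (M := KrsM) (t G) ι (fun i => t (c i)) htinv ν _ (by
      rw [← krsTau_anti d dbar ev hc _ hd]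
      change _ = t _
      rw [map_add, map_sum, htd]
      congr 1
      refine Finset.sum_congr rfl fun i _ => ?_
      rw [htinv2, htd, map_mul, map_mul, htc])
    (fun E h1 h2 h3 => hE E ⟨h1, h2, h3⟩) 1 one_ne_zero
  obtain ⟨z, hz⟩ := key
  have h4 : PowerSeries.coeff 1 (t G) = algebraMap (PowerSeries ℂ) KrsM (krsEs d ev (dbar G)) := by
    change PowerSeries.coeff 1 (krsJ (krsTau d dbar ev G)) = _
    rw [krsJ, PowerSeries.coeff_map, krsTau_coeff]
    simp
  rw [h4, IsScalarTower.algebraMap_apply ℂ (PowerSeries ℂ) KrsM] at hz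
  have h5 := (IsFractionRing.injective (PowerSeries ℂ) KrsM) hz
  have h6 := congrArg (PowerSeries.coeff 1) h5
  rw [krsEs_coeff, PowerSeries.algebraMap_apply] at h6
  simpa [PowerSeries.coeff_C] using h6.symm

end Alg6


section Alg7

variable {A : Type} [CommRing A] [Algebra ℂ A] (d dbar : Derivation ℂ A A) (ev : A →ₐ[ℂ] ℂ)

lemma krsTau_cc (a : A) :
    PowerSeries.constantCoeff (PowerSeries.constantCoeff (krsTau d dbar ev a)) = ev a := by
  rw [← PowerSeries.coeff_zero_eq_constantCoeff_apply,
    ← PowerSeries.coeff_zero_eq_constantCoeff_apply, krsTau_coeff, krsEs_coeff]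
  simp

set_option maxHeartbeats 2000000 in
lemma krs_nash {B : Type} [CommRing B] [Algebra ℂ B] {σ : Type} (X : σ → B) (φ : B →ₐ[ℂ] A)
    (hD : ∀ v : σ → ℂ, ∃ D : Derivation ℂ B B, ∀ i, D (X i) = algebraMap ℂ B (v i))
    (y : B) (P : Polynomial (MvPolynomial σ ℂ)) (hP : P ≠ 0)
    (hy : Polynomial.eval₂ ((MvPolynomial.aeval X : MvPolynomial σ ℂ →ₐ[ℂ] B) : _ →+* B) y P = 0)
    (E : Subfield KrsL) (hE : KrsE E) (hX : ∀ i, krsT d dbar ev (φ (X i)) ∈ E) :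
    krsT d dbar ev (φ y) ∈ E := by
  obtain ⟨m, hm⟩ : ∃ m, P.coeff m ≠ 0 := by
    by_contra! h
    exact hP (Polynomial.ext (by simpa using h))
  obtain ⟨y0, hy0⟩ : ∃ y0, MvPolynomial.eval y0 (P.coeff m) ≠ 0 := by
    by_contra! h
    exact hm (MvPolynomial.funext (by simpa using h))
  obtain ⟨D, hDX⟩ := hD (fun i => y0 i - ev (φ (X i)))
  have hcE : ∀ z : ℂ, krsT d dbar ev (algebraMap ℂ A z) ∈ E := fun z =>
    krsT_hol d dbar ev _ (by simp) E hE
  let iE : ℂ →+* E := ((krsT d dbar ev).comp (algebraMap ℂ A)).codRestrict E hcE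
  let v : σ → ℂ := fun i => y0 i - ev (φ (X i))
  let Θ : B →+* PowerSeries KrsL :=
    (PowerSeries.map ((krsT d dbar ev).comp (φ : B →+* A))).comp (krsTayHom D)
  let ρ : MvPolynomial σ ℂ →+* PowerSeries E :=
    MvPolynomial.eval₂Hom (PowerSeries.C.comp iE)
      (fun i => PowerSeries.C ⟨_, hX i⟩ + PowerSeries.C (iE (v i)) * PowerSeries.X)
  let ρ' : MvPolynomial σ ℂ →+* Polynomial (PowerSeries (PowerSeries ℂ)) :=
    MvPolynomial.eval₂Hom (Polynomial.C.comp ((krsTau d dbar ev).comp (algebraMap ℂ A)))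
      (fun i => Polynomial.C (krsTau d dbar ev (φ (X i)))
        + Polynomial.C (krsTau d dbar ev (algebraMap ℂ A (v i))) * Polynomial.X)
  have hTh : ∀ b, Θ b = PowerSeries.map ((krsT d dbar ev).comp (φ : B →+* A)) (krsTay D b) :=
    fun b => rfl
  have hThX : ∀ i, Θ (X i) = PowerSeries.C (krsT d dbar ev (φ (X i))) +
      PowerSeries.C (krsT d dbar ev (algebraMap ℂ A (v i))) * PowerSeries.X := by
    intro i
    have h1 : krsTay D (X i) = PowerSeries.C (X i) +
        PowerSeries.C (algebraMap ℂ B (v i)) * PowerSeries.X := by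
      ext k
      rw [krsTay_coeff]
      rcases k with _ | _ | k
      · simp
      · simp [PowerSeries.coeff_C, hDX, v]
      · have : D^[k+1+1] (X i) = 0 := by
          rw [Function.iterate_add_apply, Function.iterate_add_apply]
          simp only [Function.iterate_one, hDX, Derivation.map_algebraMap]
          exact Function.iterate_fixed (map_zero D) k
        rw [this]
        simp [PowerSeries.coeff_C, PowerSeries.coeff_X]
    rw [hTh, h1]
    simp
  have hThC : ∀ z : ℂ, Θ (algebraMap ℂ B z) =
      PowerSeries.C (krsT d dbar ev (algebraMap ℂ A z)) := by
    intro z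
    rw [hTh, krsTay_const D _ (by simp)]
    simp
  have hcomp1 : (PowerSeries.map (algebraMap E KrsL)).comp ρ =
      Θ.comp ((MvPolynomial.aeval X : MvPolynomial σ ℂ →ₐ[ℂ] B) : _ →+* B) := by
    apply MvPolynomial.ringHom_ext
    · intro z
      have : Θ (algebraMap ℂ B z) = _ := hThC z
      simp [ρ, this]
      rfl
    · intro i
      simp [ρ, hThX]
      rfl
  have hcomp2 : (PowerSeries.map (algebraMap E KrsL)).comp ρ =
      ((PowerSeries.map (krsEmb.comp krsJ)).comp Polynomial.coeToPowerSeries.ringHom).comp ρ' := by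
    apply MvPolynomial.ringHom_ext
    · intro z
      simp [ρ, ρ']
      rfl
    · intro i
      simp [ρ, ρ']
      rfl
  have hρ : ρ (P.coeff m) ≠ 0 := by
    intro h
    have h1 : ((PowerSeries.map (krsEmb.comp krsJ)).comp Polynomial.coeToPowerSeries.ringHom)
        (ρ' (P.coeff m)) = 0 := by
      rw [← RingHom.comp_apply, ← hcomp2, RingHom.comp_apply, h, map_zero]
    have h2 : ρ' (P.coeff m) = 0 := by
      have hi := PowerSeries.map_injective (krsEmb.comp krsJ) (krsEmb_inj.comp krsJ_inj)
      rw [RingHom.comp_apply] at h1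
      have h3 := hi (h1.trans (map_zero _).symm)
      exact Polynomial.coe_injective _ (by simpa using h3)
    let θ : Polynomial (PowerSeries (PowerSeries ℂ)) →+* ℂ :=
      Polynomial.eval₂RingHom (PowerSeries.constantCoeff.comp PowerSeries.constantCoeff) 1
    have h4 : θ.comp ρ' = MvPolynomial.eval y0 := by
      apply MvPolynomial.ringHom_ext
      · intro z
        simp [ρ', θ, krsTau_cc]
      · intro i
        simp [ρ', θ, krsTau_cc, v]
    apply hy0
    rw [← h4, RingHom.comp_apply, h2, map_zero]
  have hQ : P.map ρ ≠ 0 := by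
    intro h
    apply hρ
    rw [← Polynomial.coeff_map, h, Polynomial.coeff_zero]
  have hfin := krs_lemmaC (Θ y) (P.map ρ) hQ (by
    rw [Polynomial.eval₂_map, hcomp1, ← Polynomial.hom_eval₂, hy, map_zero])
  have h5 : PowerSeries.constantCoeff (Θ y) = krsT d dbar ev (φ y) := by
    rw [hTh, ← PowerSeries.coeff_zero_eq_constantCoeff_apply, PowerSeries.coeff_map, krsTay_coeff]
    simp
  rw [h5] at hfin
  exact hE.halg _ hfin

end Alg7


section Alg8

/-- `y` is algebraic over the polynomials in `X` -/
def KrsNA {B : Type} [CommRing B] [Algebra ℂ B] {σ : Type} (X : σ → B) (y : B) : Prop :=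
  ∃ P : Polynomial (MvPolynomial σ ℂ), P ≠ 0 ∧
    Polynomial.eval₂ ((MvPolynomial.aeval X : MvPolynomial σ ℂ →ₐ[ℂ] B) : _ →+* B) y P = 0

lemma krs_NA_der {B : Type} [CommRing B] [IsDomain B] [Algebra ℂ B] {σ : Type} (X : σ → B)
    (hinj : Function.Injective (MvPolynomial.aeval X : MvPolynomial σ ℂ →ₐ[ℂ] B))
    (D : Derivation ℂ B B) (hDX : ∀ i, ∃ c : ℂ, D (X i) = algebraMap ℂ B c) (y : B)
    (hy : KrsNA X y) : KrsNA X (D y) := by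
  letI : Algebra (MvPolynomial σ ℂ) B :=
    ((MvPolynomial.aeval X : MvPolynomial σ ℂ →ₐ[ℂ] B) : _ →+* B).toAlgebra
  have hal : ∀ r : MvPolynomial σ ℂ, algebraMap (MvPolynomial σ ℂ) B r =
    MvPolynomial.aeval X r := fun r => rfl
  haveI : FaithfulSMul (MvPolynomial σ ℂ) B := (faithfulSMul_iff_algebraMap_injective _ _).2 hinj
  have h1 : ∀ r : MvPolynomial σ ℂ, ∃ s : MvPolynomial σ ℂ,
      D (algebraMap _ B r) = algebraMap _ B s := by
    intro r
    induction r using MvPolynomial.induction_on with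
    | C a => exact ⟨0, by simp [hal]⟩
    | add p q hp hq =>
      obtain ⟨s, hs⟩ := hp
      obtain ⟨t, ht⟩ := hq
      exact ⟨s + t, by rw [map_add, map_add, hs, ht, map_add]⟩
    | mul_X p i hp =>
      obtain ⟨s, hs⟩ := hp
      obtain ⟨c, hc⟩ := hDX i
      refine ⟨p * MvPolynomial.C c + MvPolynomial.X i * s, ?_⟩
      rw [map_mul, Derivation.leibniz, hs, map_add, map_mul, map_mul]
      simp [hal, hc]
  exact krs_alg_der D (fun r => by
    obtain ⟨s, hs⟩ := h1 r
    rw [hs]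
    exact isAlgebraic_algebraMap s) y hy

lemma krs_nash_all {A : Type} [CommRing A] [Algebra ℂ A] {n : ℕ}
    (dd db : Fin n → Derivation ℂ A A) (ev : A →ₐ[ℂ] ℂ)
    (hc : ∀ k l a, dd k (db l a) = db l (dd k a))
    {B : Type} [CommRing B] [IsDomain B] [Algebra ℂ B] {σ : Type} [Fintype σ] [DecidableEq σ]
    (X : σ → B)
    (hinj : Function.Injective (MvPolynomial.aeval X : MvPolynomial σ ℂ →ₐ[ℂ] B))
    (φ : B →ₐ[ℂ] A)
    (pd : σ → Derivation ℂ B B) (hpd : ∀ i j, pd i (X j) = if i = j then 1 else 0)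
    (Hol : B → Prop) (hHol : ∀ y i, Hol y → Hol (pd i y))
    (hch : ∀ y, Hol y → ∀ k, dd k (φ y) = ∑ i, φ (pd i y) * dd k (φ (X i)))
    (hch' : ∀ y, Hol y → ∀ k, db k (φ y) = ∑ i, φ (pd i y) * db k (φ (X i)))
    (hX : ∀ i, (∀ k, dd k (φ (X i)) = 0) ∨ (∀ k, db k (φ (X i)) = 0))
    (y : B) (hy : Hol y) (hya : KrsNA X y)
    (α β : Fin n) (E : Subfield KrsL) (hE : KrsE E) :
    krsT (dd α) (db β) ev (φ y) ∈ E ∧ (∀ k, krsT (dd α) (db β) ev (dd k (φ y)) ∈ E) ∧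
    (∀ k, krsT (dd α) (db β) ev (db k (φ y)) ∈ E) ∧
    (∀ k l, krsT (dd α) (db β) ev (dd k (db l (φ y))) ∈ E) := by
  set T := krsT (dd α) (db β) ev with hT
  have hanti : ∀ a, (∀ k, dd k a = 0) → T a ∈ E := fun a ha =>
    krsT_anti _ _ ev (hc α β) a (ha α) E hE
  have hhol : ∀ a, (∀ k, db k a = 0) → T a ∈ E := fun a ha =>
    krsT_hol _ _ ev a (ha β) E hE
  have hT0 : T 0 ∈ E := by rw [map_zero]; exact E.zero_mem
  have hX0 : ∀ i, T (φ (X i)) ∈ E := fun i => (hX i).elim (hanti _) (hhol _)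
  have hX1 : ∀ i k, T (dd k (φ (X i))) ∈ E := fun i k => (hX i).elim
    (fun h => by rw [h]; exact hT0)
    (fun h => hhol _ fun l => by rw [← hc, h, map_zero])
  have hX2 : ∀ i k, T (db k (φ (X i))) ∈ E := fun i k => (hX i).elim
    (fun h => hanti _ fun l => by rw [hc, h, map_zero])
    (fun h => by rw [h]; exact hT0)
  have hX3 : ∀ i k l, T (dd k (db l (φ (X i)))) ∈ E := fun i k l => (hX i).elim
    (fun h => by rw [hc, h, map_zero]; exact hT0)
    (fun h => by rw [h, map_zero]; exact hT0)
  have hna : ∀ y, KrsNA X y → T (φ y) ∈ E := by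
    rintro y ⟨P, hP, h⟩
    refine krs_nash _ _ ev X φ (fun v => ⟨∑ i, v i • pd i, fun j => ?_⟩) y P hP h E hE hX0
    have h0 := congrFun (map_sum (Derivation.coeFnAddMonoidHom (R := ℂ) (A := B) (M := B))
      (fun i => v i • pd i) Finset.univ) (X j)
    rw [Finset.sum_apply] at h0
    refine h0.trans ?_
    simp only [Derivation.coeFnAddMonoidHom, AddMonoidHom.coe_mk, ZeroHom.coe_mk,
      Derivation.smul_apply, hpd]
    simp [Algebra.algebraMap_eq_smul_one]
  have hder : ∀ y i, KrsNA X y → KrsNA X (pd i y) := fun y i h =>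
    krs_NA_der X hinj (pd i) (fun j => ⟨if i = j then 1 else 0, by
      rw [hpd]; split_ifs <;> simp⟩) y h
  have h1 : ∀ y, Hol y → KrsNA X y → ∀ k, T (dd k (φ y)) ∈ E := by
    intro y hy hya k
    rw [hch y hy, map_sum]
    refine E.sum_mem fun i _ => ?_
    rw [map_mul]
    exact E.mul_mem (hna _ (hder _ _ hya)) (hX1 i k)
  have h2 : ∀ y, Hol y → KrsNA X y → ∀ k, T (db k (φ y)) ∈ E := by
    intro y hy hya k
    rw [hch' y hy, map_sum]
    refine E.sum_mem fun i _ => ?_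
    rw [map_mul]
    exact E.mul_mem (hna _ (hder _ _ hya)) (hX2 i k)
  refine ⟨hna y hya, h1 y hy hya, h2 y hy hya, fun k l => ?_⟩
  rw [hch' y hy, map_sum, map_sum]
  refine E.sum_mem fun i _ => ?_
  rw [Derivation.leibniz, map_add, smul_eq_mul, smul_eq_mul, map_mul, map_mul]
  exact E.add_mem (E.mul_mem (hna _ (hder _ _ hya)) (hX3 i k l))
    (E.mul_mem (hX2 i l) (h1 _ (hHol _ _ hy) (hder _ _ hya) k))

end Alg8


section Alg9

lemma krs_lie {A : Type} [CommRing A] [Algebra ℂ A] {n : ℕ}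
    (dd db : Fin n → Derivation ℂ A A)
    (hc : ∀ k l a, dd k (db l a) = db l (dd k a))
    (hc1 : ∀ k l a, dd k (dd l a) = dd l (dd k a))
    (hc2 : ∀ k l a, db k (db l a) = db l (db k a))
    (Φ : A) (F Fb : Fin n → A)
    (hF : ∀ l j, db l (F j) = 0) (hFb : ∀ l j, dd l (Fb j) = 0) (α β : Fin n) :
    dd α (db β (∑ j, (F j * dd j Φ + Fb j * db j Φ))) =
    ∑ j, (F j * dd j (dd α (db β Φ)) + Fb j * db j (dd α (db β Φ))
      + dd α (F j) * dd j (db β Φ) + db β (Fb j) * dd α (db j Φ)) := by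
  rw [map_sum, map_sum]
  refine Finset.sum_congr rfl fun j _ => ?_
  simp only [Derivation.leibniz, map_add, smul_eq_mul, hF, hFb, map_zero, mul_zero, add_zero]
  rw [hc α β (Fb j), hFb, map_zero, ← hc j β Φ, hc1 α j, hc2 β j, hc α j]
  ring

lemma krs_abs_final {A : Type} [CommRing A] [Algebra ℂ A] {n : ℕ}
    (dd db : Fin n → Derivation ℂ A A) (ev : A →ₐ[ℂ] ℂ)
    (hc : ∀ k l a, dd k (db l a) = db l (dd k a))
    (hc1 : ∀ k l a, dd k (dd l a) = dd l (dd k a))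
    (hc2 : ∀ k l a, db k (db l a) = db l (db k a))
    (Φ : A) (ι : Type) [Fintype ι] (ψ ψ' : ι → A) (hψ : ∀ k, ψ k * ψ' k = 1) (γ : ι → ℂ)
    (hΦ : ∀ j, dd j Φ = ∑ k, algebraMap ℂ A (γ k) * (dd j (ψ k) * ψ' k))
    (hΦ' : ∀ j, db j Φ = ∑ k, algebraMap ℂ A (γ k) * (db j (ψ k) * ψ' k))
    (F Fb : Fin n → A)
    (hF : ∀ l j, db l (F j) = 0) (hFb : ∀ l j, dd l (Fb j) = 0) (α β : Fin n)
    (hE : ∀ E, KrsE E → ∀ i, 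
      krsT (dd α) (db β) ev (ψ i) ∈ E ∧ (∀ k, krsT (dd α) (db β) ev (dd k (ψ i)) ∈ E) ∧
      (∀ k, krsT (dd α) (db β) ev (db k (ψ i)) ∈ E) ∧
      (∀ k l, krsT (dd α) (db β) ev (dd k (db l (ψ i))) ∈ E))
    (dt dt' : A) (hdt : dt = Matrix.det (Matrix.of fun a b => dd a (db b Φ)))
    (hdt' : dt * dt' = 1) (lam : ℂ)
    (hKRS : - dd α (db β dt * dt') = algebraMap ℂ A lam * dd α (db β Φ) + 
      ∑ j, (F j * dd j (dd α (db β Φ)) + Fb j * db j (dd α (db β Φ))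
      + dd α (F j) * dd j (db β Φ) + db β (Fb j) * dd α (db j Φ))) :
    ev (∑ j, (F j * dd j (dd α (db β Φ)) + Fb j * db j (dd α (db β Φ))
      + dd α (F j) * dd j (db β Φ) + db β (Fb j) * dd α (db j Φ))) = 0 := by
  rw [← krs_lie dd db hc hc1 hc2 Φ F Fb hF hFb] at hKRS ⊢
  refine krs_abs (dd α) (db β) ev (hc α β) _ (Option ι) (fun o => o.elim dt ψ)
    (fun o => o.elim dt' ψ') (fun o => by cases o <;> simp [hψ, hdt'])
    (fun o => o.elim 1 fun k => lam * γ k) ?_ ?_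
  · rw [map_add, Fintype.sum_option, map_add]
    simp only [Option.elim, map_one, one_mul, map_mul, mul_assoc]
    rw [← Finset.mul_sum, ← hΦ', Derivation.leibniz _ (algebraMap ℂ A lam)]
    simp only [Derivation.map_algebraMap, smul_eq_mul, mul_zero, add_zero]
    linear_combination (-1 : A) * hKRS
  · intro E hEE
    set T := krsT (dd α) (db β) ev with hT
    have hE' := hE E hEE
    have hinv : ∀ i, T (ψ' i) ∈ E := fun i => by
      have : T (ψ' i) = (T (ψ i))⁻¹ := by
        apply eq_inv_of_mul_eq_one_right
        rw [← map_mul, hψ, map_one]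
      rw [this]
      exact E.inv_mem (hE' i).1
    have hconst : ∀ z, T (algebraMap ℂ A z) ∈ E := fun z =>
      krsT_hol _ _ ev _ (by simp) E hEE
    have hinvd : ∀ i k, T (dd k (ψ' i)) ∈ E := fun i k => by
      have h0 : dd k (ψ' i) = - (ψ' i * ψ' i) * dd k (ψ i) := by
        have h1 := congrArg (dd k) (hψ i)
        rw [Derivation.leibniz, Derivation.map_one_eq_zero, smul_eq_mul, smul_eq_mul] at h1
        linear_combination (- dd k (ψ' i)) * (hψ i) + ψ' i * h1
      rw [h0, map_mul, map_neg, map_mul]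
      exact E.mul_mem (E.neg_mem (E.mul_mem (hinv i) (hinv i))) ((hE' i).2.1 k)
    have h1 : ∀ k, T (dd k Φ) ∈ E := fun k => by
      rw [hΦ, map_sum]
      refine E.sum_mem fun i _ => ?_
      rw [map_mul, map_mul]
      exact E.mul_mem (hconst _) (E.mul_mem ((hE' i).2.1 k) (hinv i))
    have h2 : ∀ k, T (db k Φ) ∈ E := fun k => by
      rw [hΦ', map_sum]
      refine E.sum_mem fun i _ => ?_
      rw [map_mul, map_mul]
      exact E.mul_mem (hconst _) (E.mul_mem ((hE' i).2.2.1 k) (hinv i))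
    have h3 : ∀ k l, T (dd k (db l Φ)) ∈ E := fun k l => by
      rw [hΦ', map_sum, map_sum]
      refine E.sum_mem fun i _ => ?_
      rw [Derivation.leibniz, Derivation.leibniz, Derivation.map_algebraMap]
      simp only [smul_eq_mul, mul_zero, add_zero, map_mul, map_add]
      exact E.mul_mem (hconst _) (E.add_mem (E.mul_mem ((hE' i).2.2.1 l) (hinvd i k))
        (E.mul_mem (hinv i) ((hE' i).2.2.2 k l)))
    constructor
    · rw [map_sum]
      refine E.sum_mem fun j _ => ?_
      rw [map_add, map_mul, map_mul]
      exact E.add_mem (E.mul_mem (krsT_hol _ _ ev _ (hF _ _) E hEE) (h1 j))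
        (E.mul_mem (krsT_anti _ _ ev (hc α β) _ (hFb _ _) E hEE) (h2 j))
    · intro o
      cases o with
      | none =>
        change T dt ∈ E
        rw [hdt, Matrix.det_apply', map_sum]
        refine E.sum_mem fun s _ => ?_
        rw [map_mul, map_prod, map_intCast]
        exact E.mul_mem (intCast_mem E _) (E.prod_mem fun i _ => h3 _ _)
      | some i => exact (hE' i).1

end Alg9


section Germ10
open Filter Topology

variable {V : Type} [NormedAddCommGroup V] [NormedSpace ℝ V]

/-- algebra structure on germs -/
noncomputable instance krsGermAlg (p : V) : Algebra ℂ (Filter.Germ (𝓝 p) ℂ) :=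
  Algebra.ofModule
    (fun r x y => by
      induction x using Filter.Germ.inductionOn
      induction y using Filter.Germ.inductionOn
      rw [← Filter.Germ.coe_smul, ← Filter.Germ.coe_mul, ← Filter.Germ.coe_mul,
        ← Filter.Germ.coe_smul, smul_mul_assoc])
    (fun r x y => by
      induction x using Filter.Germ.inductionOn
      induction y using Filter.Germ.inductionOn
      rw [← Filter.Germ.coe_smul, ← Filter.Germ.coe_mul, ← Filter.Germ.coe_mul,
        ← Filter.Germ.coe_smul, mul_smul_comm])

/-- germs of real analytic functions -/
noncomputable def krsRA (p : V) : Subalgebra ℂ (Filter.Germ (𝓝 p) ℂ) where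
  carrier := {x | ∃ f : V → ℂ, AnalyticAt ℝ f p ∧ x = (f : Filter.Germ (𝓝 p) ℂ)}
  mul_mem' := by
    rintro _ _ ⟨f, hf, rfl⟩ ⟨g, hg, rfl⟩
    exact ⟨f * g, hf.mul hg, rfl⟩
  add_mem' := by
    rintro _ _ ⟨f, hf, rfl⟩ ⟨g, hg, rfl⟩
    exact ⟨f + g, hf.add hg, rfl⟩
  algebraMap_mem' := by
    intro z
    refine ⟨fun _ => z, analyticAt_const, ?_⟩
    rw [Algebra.algebraMap_eq_smul_one]
    change ((z • (1 : V → ℂ) : V → ℂ) : Filter.Germ (𝓝 p) ℂ) = _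
    congr 1
    ext x
    simp

/-- the germ of an analytic function -/
noncomputable def krsG {p : V} (f : V → ℂ) (hf : AnalyticAt ℝ f p) : krsRA p :=
  ⟨(f : Filter.Germ (𝓝 p) ℂ), f, hf, rfl⟩

lemma krsG_eq {p : V} {f g : V → ℂ} {hf : AnalyticAt ℝ f p} {hg : AnalyticAt ℝ g p} :
    krsG f hf = krsG g hg ↔ f =ᶠ[𝓝 p] g := by
  exact Subtype.ext_iff.trans Filter.Germ.coe_eq

lemma krsG_ex {p : V} (a : krsRA p) : ∃ f, ∃ hf : AnalyticAt ℝ f p, a = krsG f hf := by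
  obtain ⟨x, f, hf, rfl⟩ := a
  exact ⟨f, hf, rfl⟩

lemma krsG_add {p : V} {f g : V → ℂ} (hf : AnalyticAt ℝ f p) (hg : AnalyticAt ℝ g p) :
    krsG f hf + krsG g hg = krsG (fun z => f z + g z) (hf.add hg) := rfl

lemma krsG_mul {p : V} {f g : V → ℂ} (hf : AnalyticAt ℝ f p) (hg : AnalyticAt ℝ g p) :
    krsG f hf * krsG g hg = krsG (fun z => f z * g z) (hf.mul hg) := rfl

lemma krsG_neg {p : V} {f : V → ℂ} (hf : AnalyticAt ℝ f p)  :
    - krsG f hf = krsG (fun z => - f z) hf.neg := rfl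

lemma krsG_smul {p : V} {f : V → ℂ} (c : ℂ) (hf : AnalyticAt ℝ f p) :
    c • krsG f hf = krsG (fun z => c * f z) (analyticAt_const.mul hf) := rfl

lemma krsG_one {p : V} : (1 : krsRA p) = krsG (fun _ => 1) analyticAt_const := rfl

lemma krsG_zero {p : V} : (0 : krsRA p) = krsG (fun _ => 0) analyticAt_const := rfl

lemma krsG_const {p : V} (c : ℂ) :
    algebraMap ℂ (krsRA p) c = krsG (fun _ => c) analyticAt_const := by
  rw [Algebra.algebraMap_eq_smul_one, krsG_one, krsG_smul, krsG_eq]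
  simp

lemma krsG_sum {p : V} {ι : Type} (s : Finset ι) {f : ι → V → ℂ}
    (hf : ∀ i, AnalyticAt ℝ (f i) p) :
    ∑ i ∈ s, krsG (f i) (hf i) = krsG (fun z => ∑ i ∈ s, f i z)
      (Finset.analyticAt_fun_sum s fun i _ => hf i) := by
  classical
  induction s using Finset.induction_on with
  | empty => simp [krsG_zero]
  | insert a s ha ih =>
    rw [Finset.sum_insert ha, ih, krsG_add, krsG_eq]
    exact Eventually.of_forall fun z => by simp [Finset.sum_insert ha]

lemma krsG_prod {p : V} {ι : Type} (s : Finset ι) {f : ι → V → ℂ}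
    (hf : ∀ i, AnalyticAt ℝ (f i) p) :
    ∏ i ∈ s, krsG (f i) (hf i) = krsG (fun z => ∏ i ∈ s, f i z)
      (Finset.analyticAt_fun_prod s fun i _ => hf i) := by
  classical
  induction s using Finset.induction_on with
  | empty => simp [krsG_one]
  | insert a s ha ih =>
    rw [Finset.prod_insert ha, ih, krsG_mul, krsG_eq]
    exact Eventually.of_forall fun z => by simp [Finset.prod_insert ha]

/-- evaluation at the base point -/
noncomputable def krsEv (p : V) : krsRA p →ₐ[ℂ] ℂ :=
  AlgHom.ofLinearMap
    { toFun := fun a => (a : Filter.Germ (𝓝 p) ℂ).value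
      map_add' := by
        intro a b
        obtain ⟨f, hf, rfl⟩ := krsG_ex a
        obtain ⟨g, hg, rfl⟩ := krsG_ex b
        rfl
      map_smul' := by
        intro c b
        obtain ⟨g, hg, rfl⟩ := krsG_ex b
        rfl } rfl (by
        intro a b
        obtain ⟨f, hf, rfl⟩ := krsG_ex a
        obtain ⟨g, hg, rfl⟩ := krsG_ex b
        rfl)

lemma krsEv_G {p : V} {f : V → ℂ} (hf : AnalyticAt ℝ f p) : krsEv p (krsG f hf) = f p := rfl

lemma krs_an_dir {p : V} {f : V → ℂ} (v : V) (hf : AnalyticAt ℝ f p) :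
    AnalyticAt ℝ (fun z => fderiv ℝ f z v) p := by
  have h := hf.fderiv
  exact (ContinuousLinearMap.apply ℝ ℂ v).analyticAt _ |>.comp h

lemma krs_ev_diff {p : V} {f : V → ℂ} (hf : AnalyticAt ℝ f p) :
    ∀ᶠ z in 𝓝 p, DifferentiableAt ℝ f z :=
  hf.eventually_analyticAt.mono fun z h => h.differentiableAt

/-- directional derivative on functions -/
noncomputable def krsDirF {p : V} (v : V) (a : krsRA p) : krsRA p :=
  krsG (fun z => fderiv ℝ (krsG_ex a).choose z v)
    (krs_an_dir v (krsG_ex a).choose_spec.choose)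

lemma krsDirF_G {p : V} (v : V) {f : V → ℂ} (hf : AnalyticAt ℝ f p) :
    krsDirF v (krsG f hf) = krsG (fun z => fderiv ℝ f z v) (krs_an_dir v hf) := by
  rw [krsDirF, krsG_eq]
  have h := (krsG_ex (krsG f hf)).choose_spec.choose_spec
  rw [krsG_eq] at h
  filter_upwards [h.fderiv (𝕜 := ℝ)] with z hz
  rw [hz]

/-- directional derivative as a derivation -/
noncomputable def krsDir {p : V} (v : V) : Derivation ℂ (krsRA p) (krsRA p) :=
  Derivation.mk'
    { toFun := krsDirF v
      map_add' := by
        intro a b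
        obtain ⟨f, hf, rfl⟩ := krsG_ex a
        obtain ⟨g, hg, rfl⟩ := krsG_ex b
        rw [krsG_add, krsDirF_G, krsDirF_G, krsDirF_G, krsG_add, krsG_eq]
        filter_upwards [krs_ev_diff hf, krs_ev_diff hg] with z h1 h2
        rw [fderiv_fun_add h1 h2]
        rfl
      map_smul' := by
        intro c b
        obtain ⟨g, hg, rfl⟩ := krsG_ex b
        rw [krsG_smul, krsDirF_G, krsDirF_G, RingHom.id_apply, krsG_smul, krsG_eq]
        filter_upwards [krs_ev_diff hg] with z h2
        rw [fderiv_const_mul h2]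
        rfl }
    (by
      intro a b
      obtain ⟨f, hf, rfl⟩ := krsG_ex a
      obtain ⟨g, hg, rfl⟩ := krsG_ex b
      change krsDirF v _ = _ * krsDirF v _ + _ * krsDirF v _
      rw [krsG_mul, krsDirF_G, krsDirF_G, krsDirF_G, krsG_mul, krsG_mul, krsG_add, krsG_eq]
      filter_upwards [krs_ev_diff hf, krs_ev_diff hg] with z h1 h2
      rw [fderiv_fun_mul h1 h2]
      rfl)

lemma krsDir_G {p : V} (v : V) {f : V → ℂ} (hf : AnalyticAt ℝ f p) :
    krsDir v (krsG f hf) = krsG (fun z => fderiv ℝ f z v) (krs_an_dir v hf) :=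
  krsDirF_G v hf

lemma krsDir_comm {p : V} (v w : V) (a : krsRA p) :
    krsDir v (krsDir w a) = krsDir w (krsDir v a) := by
  obtain ⟨f, hf, rfl⟩ := krsG_ex a
  simp only [krsDir_G]
  rw [krsG_eq]
  filter_upwards [hf.eventually_analyticAt] with z hz
  have h1 : ∀ u : V, fderiv ℝ (fun x => fderiv ℝ f x u) z =
      (ContinuousLinearMap.apply ℝ ℂ u).comp (fderiv ℝ (fderiv ℝ f) z) := fun u => by
    have h2 : HasFDerivAt (fderiv ℝ f) (fderiv ℝ (fderiv ℝ f) z) z :=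
      hz.fderiv.differentiableAt.hasFDerivAt
    exact ((ContinuousLinearMap.apply ℝ ℂ u).hasFDerivAt.comp z h2).fderiv
  rw [h1, h1]
  have hs : IsSymmSndFDerivAt ℝ f z :=
    hz.contDiffAt.isSymmSndFDerivAt (n := 2) (by simp)
  exact hs v w

instance krsRA_domain (p : V) : IsDomain (krsRA p) := by
  haveI : Nontrivial (krsRA p) := ⟨0, 1, fun h => by
    have := congrArg (krsEv p) h
    simp at this⟩
  haveI : NoZeroDivisors (krsRA p) := ⟨by
    intro a b hab
    obtain ⟨f, hf, rfl⟩ := krsG_ex a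
    obtain ⟨g, hg, rfl⟩ := krsG_ex b
    rw [krsG_mul, krsG_zero, krsG_eq] at hab
    rw [krsG_zero, krsG_eq, krsG_eq]
    by_contra! hne
    obtain ⟨hne1, hne2⟩ := hne
    obtain ⟨r, hr, hball⟩ := Metric.eventually_nhds_iff_ball.1
      (hf.eventually_analyticAt.and (hg.eventually_analyticAt.and hab))
    have hconn : IsPreconnected (Metric.ball p r) := (convex_ball p r).isPreconnected
    have hpr : p ∈ Metric.ball p r := Metric.mem_ball_self hr
    have hfa : AnalyticOnNhd ℝ f (Metric.ball p r) := fun z hz => (hball z hz).1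
    have hga : AnalyticOnNhd ℝ g (Metric.ball p r) := fun z hz => (hball z hz).2.1
    have hz0 : ∃ z ∈ Metric.ball p r, f z ≠ 0 := by
      by_contra! h
      exact hne1 (Filter.mem_of_superset (Metric.isOpen_ball.mem_nhds hpr) h)
    obtain ⟨z0, hz0, hfz0⟩ := hz0
    have hg0 : g =ᶠ[𝓝 z0] 0 := by
      filter_upwards [(hfa z0 hz0).continuousAt.eventually_ne hfz0,
        Metric.isOpen_ball.mem_nhds hz0] with z h1 h2
      have h3 := (hball z h2).2.2
      exact (mul_eq_zero.1 h3).resolve_left h1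
    have h := hga.eqOn_zero_of_preconnected_of_eventuallyEq_zero hconn hz0 hg0
    exact hne2 (Filter.mem_of_superset (Metric.isOpen_ball.mem_nhds hpr) h)⟩
  exact NoZeroDivisors.to_isDomain _

/-- inverse of a nonvanishing germ -/
lemma krsG_inv {p : V} {f : V → ℂ} (hf : AnalyticAt ℝ f p) (h0 : f p ≠ 0) :
    krsG f hf * krsG (fun z => (f z)⁻¹) (hf.fun_inv h0) = 1 := by
  rw [krsG_mul, krsG_one, krsG_eq]
  filter_upwards [hf.continuousAt.eventually_ne h0] with z hz
  exact mul_inv_cancel₀ hz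

end Germ10


section Germ11
open Filter Topology

variable {V : Type} [NormedAddCommGroup V] [NormedSpace ℝ V]
variable {W : Type} [NormedAddCommGroup W] [NormedSpace ℝ W]

/-- pullback of germs -/
noncomputable def krsPull {p : V} (x : V → W) (hx : AnalyticAt ℝ x p) :
    krsRA (x p) →ₐ[ℂ] krsRA p :=
  AlgHom.ofLinearMap
    { toFun := fun a => ⟨(a : Filter.Germ (𝓝 (x p)) ℂ).compTendsto x hx.continuousAt, by
        obtain ⟨f, hf, rfl⟩ := krsG_ex a
        exact ⟨f ∘ x, hf.comp hx, rfl⟩⟩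
      map_add' := by
        intro a b
        obtain ⟨f, hf, rfl⟩ := krsG_ex a
        obtain ⟨g, hg, rfl⟩ := krsG_ex b
        rfl
      map_smul' := by
        intro c b
        obtain ⟨g, hg, rfl⟩ := krsG_ex b
        rfl } rfl (by
        intro a b
        obtain ⟨f, hf, rfl⟩ := krsG_ex a
        obtain ⟨g, hg, rfl⟩ := krsG_ex b
        rfl)

lemma krsPull_G {p : V} (x : V → W) (hx : AnalyticAt ℝ x p) {f : W → ℂ}
    (hf : AnalyticAt ℝ f (x p)) :
    krsPull x hx (krsG f hf) = krsG (fun z => f (x z)) (hf.comp hx) := rfl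

variable {σ : Type} [Fintype σ] [DecidableEq σ]

lemma krs_an_coord (x0 : σ → ℂ) (i : σ) : AnalyticAt ℝ (fun x : σ → ℂ => x i) x0 :=
  (ContinuousLinearMap.proj (R := ℝ) (φ := fun _ : σ => ℂ) i).analyticAt x0

/-- coordinate germs -/
noncomputable def krsX (x0 : σ → ℂ) (i : σ) : krsRA x0 := krsG (fun x => x i) (krs_an_coord x0 i)

lemma krsX_aeval (x0 : σ → ℂ) (q : MvPolynomial σ ℂ) :
    ∃ h : AnalyticAt ℝ (fun x => MvPolynomial.eval x q) x0,
    MvPolynomial.aeval (krsX x0) q = krsG (fun x => MvPolynomial.eval x q) h := by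
  induction q using MvPolynomial.induction_on with
  | C a => 
    simp only [MvPolynomial.eval_C, MvPolynomial.aeval_C, krsG_const]
    exact ⟨analyticAt_const, trivial⟩
  | add p q hp hq =>
    obtain ⟨h1, e1⟩ := hp
    obtain ⟨h2, e2⟩ := hq
    simp only [map_add, e1, e2, krsG_add]
    exact ⟨h1.add h2, trivial⟩
  | mul_X p i hp =>
    obtain ⟨h1, e1⟩ := hp
    simp only [map_mul, e1, MvPolynomial.aeval_X, MvPolynomial.eval_X, krsX, krsG_mul]
    exact ⟨h1.mul (krs_an_coord x0 i), trivial⟩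

lemma krsX_inj (x0 : σ → ℂ) :
    Function.Injective (MvPolynomial.aeval (krsX x0) : MvPolynomial σ ℂ →ₐ[ℂ] krsRA x0) := by
  rw [injective_iff_map_eq_zero]
  intro q hq
  obtain ⟨h, e⟩ := krsX_aeval x0 q
  rw [e, krsG_zero, krsG_eq] at hq
  obtain ⟨r, hr, hball⟩ := Metric.eventually_nhds_iff_ball.1 hq
  refine MvPolynomial.funext_set (fun i => Metric.ball (x0 i) r) ?_ ?_
  · intro i
    exact infinite_of_mem_nhds (x0 i) (Metric.ball_mem_nhds _ hr)
  · intro x hx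
    rw [map_zero]
    apply hball
    rw [ball_pi _ hr]
    exact hx

lemma krsNA_of (x0 : σ → ℂ) (S : Set (σ → ℂ)) (hS : S ∈ 𝓝 x0) (ξ : (σ → ℂ) → ℂ)
    (hξ : AnalyticAt ℝ ξ x0) (h : NashAlg σ S ξ) : KrsNA (krsX x0) (krsG ξ hξ) := by
  obtain ⟨P, hP, hz⟩ := h
  refine ⟨P, hP, ?_⟩
  have key : ∀ P : Polynomial (MvPolynomial σ ℂ), 
      ∃ h : AnalyticAt ℝ (fun x => Polynomial.eval₂ (MvPolynomial.eval x) (ξ x) P) x0,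
      Polynomial.eval₂ ((MvPolynomial.aeval (krsX x0) : MvPolynomial σ ℂ →ₐ[ℂ] krsRA x0) :
        MvPolynomial σ ℂ →+* krsRA x0) (krsG ξ hξ) P = krsG _ h := by
    intro P
    induction P using Polynomial.induction_on with
    | C a =>
      simp only [Polynomial.eval₂_C]
      exact krsX_aeval x0 a
    | add p q hp hq =>
      obtain ⟨h1, e1⟩ := hp
      obtain ⟨h2, e2⟩ := hq
      simp only [Polynomial.eval₂_add, e1, e2, krsG_add]
      exact ⟨h1.add h2, trivial⟩
    | monomial k a hk =>
      obtain ⟨h1, e1⟩ := hk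
      have e : (Polynomial.C a * Polynomial.X ^ (k+1)) =
        Polynomial.C a * Polynomial.X ^ k * Polynomial.X := by ring
      simp only [e, Polynomial.eval₂_mul_X, e1, krsG_mul]
      exact ⟨h1.mul hξ, trivial⟩
  obtain ⟨h, e⟩ := key P
  rw [e, krsG_zero, krsG_eq]
  filter_upwards [hS] with x hx using hz x hx

/-- holomorphic germs -/
def KrsHol (x0 : σ → ℂ) (y : krsRA x0) : Prop :=
  ∃ (f : (σ → ℂ) → ℂ) (h : AnalyticAt ℝ f x0), AnalyticAt ℂ f x0 ∧ y = krsG f h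

lemma krsHol_dir (x0 : σ → ℂ) (y : krsRA x0) (v : σ → ℂ) (hy : KrsHol x0 y) :
    KrsHol x0 (krsDir v y) := by
  obtain ⟨f, h, hc, rfl⟩ := hy
  have h1 : AnalyticAt ℂ (fun z => fderiv ℂ f z v) x0 :=
    (ContinuousLinearMap.apply ℂ ℂ v).analyticAt _ |>.comp hc.fderiv
  refine ⟨fun z => fderiv ℂ f z v, h1.restrictScalars, h1, ?_⟩
  rw [krsDir_G, krsG_eq]
  filter_upwards [hc.eventually_analyticAt] with z hz
  rw [hz.differentiableAt.fderiv_restrictScalars ℝ]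
  rfl

lemma krsPull_chain {p : V} (x : V → (σ → ℂ)) (hx : AnalyticAt ℝ x p) (y : krsRA (x p))
    (hy : KrsHol (x p) y) (v : V) :
    krsDir v (krsPull x hx y) = ∑ i, krsPull x hx (krsDir (Pi.single i 1) y) *
      krsDir v (krsPull x hx (krsX (x p) i)) := by
  obtain ⟨f, h, hc, rfl⟩ := hy
  simp only [krsX, krsPull_G, krsDir_G, krsG_mul, krsG_sum]
  rw [krsG_eq]
  filter_upwards [hx.eventually_analyticAt,
    hx.continuousAt.eventually hc.eventually_analyticAt] with z h1 h2
  have hd := h2.differentiableAt.hasFDerivAt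
  have hxz := h1.differentiableAt.hasFDerivAt
  have e1 : fderiv ℝ (fun z => f (x z)) z v = fderiv ℂ f (x z) (fderiv ℝ x z v) :=  by
    have := ((hd.restrictScalars ℝ).comp z hxz).fderiv
    exact congrArg (fun L => L v) this
  have e2 : ∀ i, fderiv ℝ (fun z => x z i) z v = fderiv ℝ x z v i := fun i => by
    have := ((ContinuousLinearMap.proj (R := ℝ) (φ := fun _ : σ => ℂ) i).hasFDerivAt.comp
      z hxz).fderiv
    exact congrArg (fun L => L v) this
  have e3 : ∀ w, fderiv ℝ f (x z) w = fderiv ℂ f (x z) w := fun w => by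
    rw [h2.differentiableAt.fderiv_restrictScalars ℝ]; rfl
  rw [e1]
  simp only [e2, e3]
  conv_lhs => rw [pi_eq_sum_univ' (fderiv ℝ x z v), map_sum]
  refine Finset.sum_congr rfl fun i _ => ?_
  rw [map_smul, smul_eq_mul, mul_comm]

variable {n : ℕ}

/-- Wirtinger derivation -/
noncomputable def krsDD {p : Fin n → ℂ} (α : Fin n) : Derivation ℂ (krsRA p) (krsRA p) :=
  (2⁻¹ : ℂ) • (krsDir (p := p) (Pi.single α 1 : Fin n → ℂ) - I • krsDir (p := p) (Pi.single α I : Fin n → ℂ))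

/-- conjugate Wirtinger derivation -/
noncomputable def krsDB {p : Fin n → ℂ} (α : Fin n) : Derivation ℂ (krsRA p) (krsRA p) :=
  (2⁻¹ : ℂ) • (krsDir (p := p) (Pi.single α 1 : Fin n → ℂ) + I • krsDir (p := p) (Pi.single α I : Fin n → ℂ))

lemma krsDD_apply {p : Fin n → ℂ} (α : Fin n) (a : krsRA p) : krsDD α a =
    (2⁻¹ : ℂ) • (krsDir (Pi.single α 1 : Fin n → ℂ) a -
      I • krsDir (Pi.single α I : Fin n → ℂ) a) := rfl

lemma krsDB_apply {p : Fin n → ℂ} (α : Fin n) (a : krsRA p) : krsDB α a =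
    (2⁻¹ : ℂ) • (krsDir (Pi.single α 1 : Fin n → ℂ) a +
      I • krsDir (Pi.single α I : Fin n → ℂ) a) := rfl

lemma krs_an_wirt {p : Fin n → ℂ} (α : Fin n) {f : (Fin n → ℂ) → ℂ} (hf : AnalyticAt ℝ f p) :
    AnalyticAt ℝ (wirt α f) p :=
  ((krs_an_dir _ hf).sub (analyticAt_const.mul (krs_an_dir _ hf))).fun_div analyticAt_const
    two_ne_zero

lemma krs_an_wirtBar {p : Fin n → ℂ} (α : Fin n) {f : (Fin n → ℂ) → ℂ} (hf : AnalyticAt ℝ f p) :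
    AnalyticAt ℝ (wirtBar α f) p :=
  ((krs_an_dir _ hf).add (analyticAt_const.mul (krs_an_dir _ hf))).fun_div analyticAt_const
    two_ne_zero

lemma krsDD_G {p : Fin n → ℂ} (α : Fin n) {f : (Fin n → ℂ) → ℂ} (hf : AnalyticAt ℝ f p) :
    krsDD α (krsG f hf) = krsG (wirt α f) (krs_an_wirt α hf) := by
  rw [krsDD_apply, krsDir_G, krsDir_G, krsG_smul, sub_eq_add_neg, krsG_neg, krsG_add, krsG_smul,
    krsG_eq]
  exact Eventually.of_forall fun z => by rw [wirt]; ring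

lemma krsDB_G {p : Fin n → ℂ} (α : Fin n) {f : (Fin n → ℂ) → ℂ} (hf : AnalyticAt ℝ f p) :
    krsDB α (krsG f hf) = krsG (wirtBar α f) (krs_an_wirtBar α hf) := by
  rw [krsDB_apply, krsDir_G, krsDir_G, krsG_smul, krsG_add, krsG_smul,
    krsG_eq]
  exact Eventually.of_forall fun z => by rw [wirtBar]; ring

lemma krs_comm1 {p : Fin n → ℂ} (k l : Fin n) (a : krsRA p) :
    krsDD k (krsDB l a) = krsDB l (krsDD k a) := by
  simp only [krsDD_apply, krsDB_apply, Derivation.map_smul, map_sub, map_add]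
  rw [krsDir_comm (Pi.single k (1 : ℂ) : Fin n → ℂ) (Pi.single l (1 : ℂ)), krsDir_comm (Pi.single k (1 : ℂ) : Fin n → ℂ) (Pi.single l I),
    krsDir_comm (Pi.single k I : Fin n → ℂ) (Pi.single l (1 : ℂ)), krsDir_comm (Pi.single k I : Fin n → ℂ) (Pi.single l I)]
  module

lemma krs_comm2 {p : Fin n → ℂ} (k l : Fin n) (a : krsRA p) :
    krsDD k (krsDD l a) = krsDD l (krsDD k a) := by
  simp only [krsDD_apply, krsDB_apply, Derivation.map_smul, map_sub, map_add]
  rw [krsDir_comm (Pi.single k (1 : ℂ) : Fin n → ℂ) (Pi.single l (1 : ℂ)), krsDir_comm (Pi.single k (1 : ℂ) : Fin n → ℂ) (Pi.single l I),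
    krsDir_comm (Pi.single k I : Fin n → ℂ) (Pi.single l (1 : ℂ)), krsDir_comm (Pi.single k I : Fin n → ℂ) (Pi.single l I)]
  module

lemma krs_comm3 {p : Fin n → ℂ} (k l : Fin n) (a : krsRA p) :
    krsDB k (krsDB l a) = krsDB l (krsDB k a) := by
  simp only [krsDD_apply, krsDB_apply, Derivation.map_smul, map_sub, map_add]
  rw [krsDir_comm (Pi.single k (1 : ℂ) : Fin n → ℂ) (Pi.single l (1 : ℂ)), krsDir_comm (Pi.single k (1 : ℂ) : Fin n → ℂ) (Pi.single l I),
    krsDir_comm (Pi.single k I : Fin n → ℂ) (Pi.single l (1 : ℂ)), krsDir_comm (Pi.single k I : Fin n → ℂ) (Pi.single l I)]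
  module

lemma krsDD_chain {p : Fin n → ℂ} (x : (Fin n → ℂ) → (σ → ℂ)) (hx : AnalyticAt ℝ x p)
    (y : krsRA (x p)) (hy : KrsHol (x p) y) (k : Fin n) :
    krsDD k (krsPull x hx y) = ∑ i, krsPull x hx (krsDir (Pi.single i 1) y) *
      krsDD k (krsPull x hx (krsX (x p) i)) := by
  simp only [krsDD_apply]
  rw [krsPull_chain x hx y hy, krsPull_chain x hx y hy, Finset.smul_sum, ← Finset.sum_sub_distrib,
    Finset.smul_sum]
  refine Finset.sum_congr rfl fun i _ => ?_
  rw [mul_smul_comm, mul_sub, mul_smul_comm]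

lemma krsDB_chain {p : Fin n → ℂ} (x : (Fin n → ℂ) → (σ → ℂ)) (hx : AnalyticAt ℝ x p)
    (y : krsRA (x p)) (hy : KrsHol (x p) y) (k : Fin n) :
    krsDB k (krsPull x hx y) = ∑ i, krsPull x hx (krsDir (Pi.single i 1) y) *
      krsDB k (krsPull x hx (krsX (x p) i)) := by
  simp only [krsDB_apply]
  rw [krsPull_chain x hx y hy, krsPull_chain x hx y hy, Finset.smul_sum, ← Finset.sum_add_distrib,
    Finset.smul_sum]
  refine Finset.sum_congr rfl fun i _ => ?_
  rw [mul_smul_comm, mul_add, mul_smul_comm]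

/-- holomorphic functions are killed by `∂̄` -/
lemma krs_hol_wirtBar {f : (Fin n → ℂ) → ℂ} {z : Fin n → ℂ} (hf : DifferentiableAt ℂ f z)
    (k : Fin n) : wirtBar k f z = 0 := by
  have e : (Pi.single k I : Fin n → ℂ) = I • (Pi.single k 1 : Fin n → ℂ) := by
    rw [← Pi.single_smul]; simp
  rw [wirtBar, hf.fderiv_restrictScalars ℝ, e]
  simp only [ContinuousLinearMap.coe_restrictScalars', map_smul, smul_eq_mul]
  rw [← mul_assoc, I_mul_I]
  simp

lemma krs_conj_fderiv {f : (Fin n → ℂ) → ℂ} {z : Fin n → ℂ} (hf : DifferentiableAt ℝ f z)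
    (v : Fin n → ℂ) : fderiv ℝ (fun w => starRingEnd ℂ (f w)) z v =
      starRingEnd ℂ (fderiv ℝ f z v) := by
  have := (Complex.conjCLE.toContinuousLinearMap.hasFDerivAt.comp z hf.hasFDerivAt).fderiv
  exact congrArg (fun L => L v) this

lemma krs_wirtBar_conj {f : (Fin n → ℂ) → ℂ} {z : Fin n → ℂ} (hf : DifferentiableAt ℝ f z)
    (k : Fin n) : wirtBar k (fun w => starRingEnd ℂ (f w)) z = starRingEnd ℂ (wirt k f z) := by
  rw [wirtBar, wirt, krs_conj_fderiv hf, krs_conj_fderiv hf]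
  simp [Complex.conj_I, Complex.conj_ofNat]

lemma krs_wirt_conj {f : (Fin n → ℂ) → ℂ} {z : Fin n → ℂ} (hf : DifferentiableAt ℝ f z)
    (k : Fin n) : wirt k (fun w => starRingEnd ℂ (f w)) z = starRingEnd ℂ (wirtBar k f z) := by
  rw [wirtBar, wirt, krs_conj_fderiv hf, krs_conj_fderiv hf]
  simp [Complex.conj_I, sub_eq_add_neg, Complex.conj_ofNat]

lemma krs_an_conj {p : V} {f : V → ℂ} (hf : AnalyticAt ℝ f p) :
    AnalyticAt ℝ (fun w => starRingEnd ℂ (f w)) p :=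
  (Complex.conjCLE.toContinuousLinearMap.analyticAt _).comp hf

lemma krsDB_hol {p : Fin n → ℂ} {f : (Fin n → ℂ) → ℂ} (hf : AnalyticAt ℂ f p) (k : Fin n) :
    krsDB k (krsG f hf.restrictScalars) = 0 := by
  rw [krsDB_G, krsG_zero, krsG_eq]
  filter_upwards [hf.eventually_analyticAt] with z hz
  exact krs_hol_wirtBar hz.differentiableAt k

lemma krsDD_anti {p : Fin n → ℂ} {f : (Fin n → ℂ) → ℂ} (hf : AnalyticAt ℂ f p) (k : Fin n) :
    krsDD k (krsG (fun w => starRingEnd ℂ (f w)) (krs_an_conj hf.restrictScalars)) = 0 := by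
  rw [krsDD_G, krsG_zero, krsG_eq]
  filter_upwards [hf.eventually_analyticAt] with z hz
  rw [krs_wirt_conj (hz.differentiableAt.restrictScalars ℝ), krs_hol_wirtBar hz.differentiableAt,
    map_zero]

end Germ11


section An12
open Filter Topology

lemma krs_conjVec_conjVec {n : ℕ} (z : Fin n → ℂ) : conjVec (conjVec z) = z := by
  ext i; simp [conjVec]

lemma krs_calabi {n : ℕ} (U : Set (Fin n → ℂ)) (hU : IsOpen U)
    (hUsymm : ∀ z ∈ U, conjVec z ∈ U) (Ψ : (Fin n → ℂ) × (Fin n → ℂ) → ℂ)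
    (hΨ : InCalabiF U Ψ) (p : Fin n → ℂ) (hp : p ∈ U) :
    ∃ h : AnalyticAt ℝ (fun z => Ψ (z, conjVec z)) p, ∀ α β : Fin n, ∀ E, KrsE E →
      krsT (krsDD (p := p) α) (krsDB (p := p) β) (krsEv p) (krsG (fun z => Ψ (z, conjVec z)) h) ∈ E ∧
      (∀ k, krsT (krsDD (p := p) α) (krsDB (p := p) β) (krsEv p) (krsDD k (krsG (fun z => Ψ (z, conjVec z)) h)) ∈ E) ∧
      (∀ k, krsT (krsDD (p := p) α) (krsDB (p := p) β) (krsEv p) (krsDB k (krsG (fun z => Ψ (z, conjVec z)) h)) ∈ E) ∧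
      (∀ k l, krsT (krsDD (p := p) α) (krsDB (p := p) β) (krsEv p) (krsDD k (krsDB l (krsG (fun z => Ψ (z, conjVec z)) h))) ∈ E) := by
  obtain ⟨m, S, ξ, f, hS, hξ, hN, hf, hrel, -⟩ := hΨ
  rw [hS.analyticOn_iff_analyticOnNhd] at hξ
  rw [hU.analyticOn_iff_analyticOnNhd] at hf
  let x : (Fin n → ℂ) → (Fin m ⊕ Fin m → ℂ) := fun z =>
    Sum.elim (f z) (fun i => starRingEnd ℂ (f z i))
  have hfi : ∀ i, AnalyticAt ℂ (fun z => f z i) p := fun i =>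
    ((ContinuousLinearMap.proj (R := ℂ) (φ := fun _ : Fin m => ℂ) i).analyticAt _).comp (hf p hp)
  have hx : AnalyticAt ℝ x p := by
    rw [analyticAt_pi_iff]
    rintro (i | i)
    · exact (hfi i).restrictScalars
    · exact krs_an_conj (hfi i).restrictScalars
  have hxS : ∀ z ∈ U, x z ∈ S ∧ Ψ (z, conjVec z) = ξ (x z) := fun z hz => by
    have := hrel z hz (conjVec z) (hUsymm z hz)
    rw [krs_conjVec_conjVec] at this
    exact this
  have hξp : AnalyticAt ℂ ξ (x p) := hξ _ (hxS p hp).1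
  have hev : (fun z => ξ (x z)) =ᶠ[𝓝 p] (fun z => Ψ (z, conjVec z)) := by
    filter_upwards [hU.mem_nhds hp] with z hz using (hxS z hz).2.symm
  have hξx : AnalyticAt ℝ (fun z => ξ (x z)) p := (hξp.restrictScalars (𝕜 := ℝ)).comp hx
  have hΨa : AnalyticAt ℝ (fun z => Ψ (z, conjVec z)) p := hξx.congr hev
  refine ⟨hΨa, fun α β E hE => ?_⟩
  have he : krsG _ hΨa = krsPull x hx (krsG ξ hξp.restrictScalars) := by
    rw [krsPull_G, krsG_eq]
    exact hev.symm
  rw [he]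
  refine krs_nash_all (fun k => krsDD k) (fun k => krsDB k) (krsEv p) (krs_comm1)
    (krsX (x p)) (krsX_inj (x p)) (krsPull x hx) (fun i => krsDir (Pi.single i 1))
    ?_ (KrsHol (x p)) (fun y i hy => krsHol_dir (x p) y _ hy)
    (fun y hy k => krsDD_chain x hx y hy k) (fun y hy k => krsDB_chain x hx y hy k)
    ?_ _ ⟨ξ, _, hξp, rfl⟩ (krsNA_of (x p) S (hS.mem_nhds (hxS p hp).1) ξ _ hN) α β E hE
  · intro i j
    have e : ∀ z : Fin m ⊕ Fin m → ℂ, fderiv ℝ (fun x : Fin m ⊕ Fin m → ℂ => x j) z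
        (Pi.single i 1) = if i = j then 1 else 0 := fun z => by
      have := (ContinuousLinearMap.proj (R := ℝ) (φ := fun _ : Fin m ⊕ Fin m => ℂ) j).hasFDerivAt
        (x := z) |>.fderiv
      rw [show fderiv ℝ (fun x : Fin m ⊕ Fin m → ℂ => x j) z = _ from this]
      simp [Pi.single_apply, eq_comm]
    rw [krsX, krsDir_G]
    simp only [e]
    split_ifs
    · rw [krsG_one]
    · rw [krsG_zero]
  · rintro (i | i)
    · right
      intro k
      exact krsDB_hol (hfi i) k
    · left
      intro k
      exact krsDD_anti (hfi i) k

/-- conjugation as a real linear map -/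
noncomputable def krsConjL (n : ℕ) : (Fin n → ℂ) →L[ℝ] (Fin n → ℂ) :=
  ContinuousLinearMap.pi fun i =>
    (Complex.conjCLE.toContinuousLinearMap).comp (ContinuousLinearMap.proj i)

lemma krsConjL_apply {n : ℕ} (z : Fin n → ℂ) : krsConjL n z = conjVec z := rfl

lemma krs_an_conjVec {n : ℕ} (p : Fin n → ℂ) : AnalyticAt ℝ (fun z => (z, conjVec z)) p :=
  analyticAt_id.prod ((krsConjL n).analyticAt p)

lemma krs_diag_fderiv {n : ℕ} {Q : (Fin n → ℂ) × (Fin n → ℂ) → ℂ} {z : Fin n → ℂ}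
    (hQ : DifferentiableAt ℂ Q (z, conjVec z)) (v : Fin n → ℂ) :
    fderiv ℝ (fun u => Q (u, conjVec u)) z v = fderiv ℂ Q (z, conjVec z) (v, conjVec v) := by
  have h1 : HasFDerivAt (fun u : Fin n → ℂ => (u, conjVec u))
      ((ContinuousLinearMap.id ℝ _).prod (krsConjL n)) z :=
    (hasFDerivAt_id z).prodMk (krsConjL n).hasFDerivAt
  have h2 := ((hQ.hasFDerivAt.restrictScalars ℝ).comp z h1).fderiv
  exact congrArg (fun L => L v) h2

lemma krs_conjVec_single {n : ℕ} (k : Fin n) (c : ℂ) :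
    conjVec (Pi.single k c : Fin n → ℂ) = Pi.single k (starRingEnd ℂ c) := by
  ext i
  by_cases h : i = k
  · subst h; simp [conjVec]
  · simp [conjVec, h]

lemma krs_diag_wirt {n : ℕ} {Q : (Fin n → ℂ) × (Fin n → ℂ) → ℂ} {z : Fin n → ℂ}
    (hQ : DifferentiableAt ℂ Q (z, conjVec z)) (k : Fin n) :
    wirt k (fun u => Q (u, conjVec u)) z = fderiv ℂ Q (z, conjVec z) (Pi.single k 1, 0) := by
  rw [wirt, krs_diag_fderiv hQ, krs_diag_fderiv hQ, krs_conjVec_single, krs_conjVec_single,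
    ← smul_eq_mul, ← map_smul, ← map_sub, div_eq_inv_mul, ← smul_eq_mul, ← map_smul]
  congr 1
  ext i
  · by_cases h : i = k
    · subst h; simp; norm_num
    · simp [h]
  · by_cases h : i = k
    · subst h; simp
    · simp [h]

lemma krs_diag_wirtBar {n : ℕ} {Q : (Fin n → ℂ) × (Fin n → ℂ) → ℂ} {z : Fin n → ℂ}
    (hQ : DifferentiableAt ℂ Q (z, conjVec z)) (k : Fin n) :
    wirtBar k (fun u => Q (u, conjVec u)) z = fderiv ℂ Q (z, conjVec z) (0, Pi.single k 1) := by
  rw [wirtBar, krs_diag_fderiv hQ, krs_diag_fderiv hQ, krs_conjVec_single, krs_conjVec_single,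
    ← smul_eq_mul, ← map_smul, ← map_add, div_eq_inv_mul, ← smul_eq_mul, ← map_smul]
  congr 1
  ext i
  · by_cases h : i = k
    · subst h; simp
    · simp [h]
  · by_cases h : i = k
    · subst h; simp; norm_num
    · simp [h]

lemma krs_mixed {n : ℕ} {P : (Fin n → ℂ) × (Fin n → ℂ) → ℂ} {z : Fin n → ℂ}
    (hP : AnalyticAt ℂ P (z, conjVec z)) (α β : Fin n) :
    mixedDeriv P α β (z, conjVec z) =
      wirt α (wirtBar β (fun u => P (u, conjVec u))) z := by
  let Q : (Fin n → ℂ) × (Fin n → ℂ) → ℂ := fun x => fderiv ℂ P x (0, Pi.single β 1)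
  have hQ : AnalyticAt ℂ Q (z, conjVec z) :=
    ((ContinuousLinearMap.apply ℂ ℂ
      ((0 : Fin n → ℂ), (Pi.single β 1 : Fin n → ℂ))).analyticAt _).comp hP.fderiv
  have e1 : wirtBar β (fun u => P (u, conjVec u)) =ᶠ[𝓝 z] fun u => Q (u, conjVec u) := by
    have := (krs_an_conjVec z).continuousAt.eventually hP.eventually_analyticAt
    filter_upwards [this] with u hu
    exact krs_diag_wirtBar hu.differentiableAt β
  have e2 : wirt α (wirtBar β (fun u => P (u, conjVec u))) z =
      wirt α (fun u => Q (u, conjVec u)) z := by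
    rw [wirt, wirt, e1.fderiv_eq]
  rw [e2, krs_diag_wirt hQ.differentiableAt, mixedDeriv]
  have hline : HasDerivAt (fun s : ℂ => (z + s • (Pi.single α 1 : Fin n → ℂ), conjVec z))
      ((Pi.single α 1 : Fin n → ℂ), (0 : Fin n → ℂ)) 0 := by
    refine HasDerivAt.prodMk ?_ (hasDerivAt_const _ _)
    simpa using ((hasDerivAt_id (0 : ℂ)).smul_const (Pi.single α 1 : Fin n → ℂ)).const_add z
  have e3 : (fun s : ℂ => deriv (fun t : ℂ => P (z + s • (Pi.single α 1 : Fin n → ℂ),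
         conjVec z + t • (Pi.single β 1 : Fin n → ℂ))) 0) =ᶠ[𝓝 0]
      fun s => Q (z + s • (Pi.single α 1 : Fin n → ℂ), conjVec z) := by
    have hc := hline.continuousAt
    have h0 : (z + (0 : ℂ) • (Pi.single α 1 : Fin n → ℂ), conjVec z) = (z, conjVec z) := by simp
    have hP' : ∀ᶠ y in 𝓝 (z + (0 : ℂ) • (Pi.single α 1 : Fin n → ℂ), conjVec z),
        AnalyticAt ℂ P y := by
      rw [h0]; exact hP.eventually_analyticAt
    have := hc.eventually hP'
    filter_upwards [this] with s hs
    have hl2 : HasDerivAt (fun t : ℂ => (z + s • (Pi.single α 1 : Fin n → ℂ),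
        conjVec z + t • (Pi.single β 1 : Fin n → ℂ)))
        ((0 : Fin n → ℂ), (Pi.single β 1 : Fin n → ℂ)) 0 := by
      refine HasDerivAt.prodMk (hasDerivAt_const _ _) ?_
      simpa using ((hasDerivAt_id (0 : ℂ)).smul_const
        (Pi.single β 1 : Fin n → ℂ)).const_add (conjVec z)
    have h3 : HasFDerivAt P (fderiv ℂ P (z + s • (Pi.single α 1 : Fin n → ℂ), conjVec z))
        (z + s • (Pi.single α 1 : Fin n → ℂ),
        conjVec z + (0 : ℂ) • (Pi.single β 1 : Fin n → ℂ)) := by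
      have e : (z + s • (Pi.single α 1 : Fin n → ℂ),
        conjVec z + (0 : ℂ) • (Pi.single β 1 : Fin n → ℂ)) =
        (z + s • (Pi.single α 1 : Fin n → ℂ), conjVec z) := by simp
      rw [e]
      exact hs.differentiableAt.hasFDerivAt
    exact (h3.comp_hasDerivAt (0 : ℂ) hl2).deriv
  rw [e3.deriv_eq]
  have h4 : HasFDerivAt Q (fderiv ℂ Q (z, conjVec z))
      (z + (0 : ℂ) • (Pi.single α 1 : Fin n → ℂ), conjVec z) := by
    have h0 : (z + (0 : ℂ) • (Pi.single α 1 : Fin n → ℂ), conjVec z) = (z, conjVec z) := by simp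
    rw [h0]
    exact hQ.differentiableAt.hasFDerivAt
  exact (h4.comp_hasDerivAt (0 : ℂ) hline).deriv

variable {V : Type} [NormedAddCommGroup V] [NormedSpace ℝ V]

lemma krs_log_fderiv {ψ : V → ℂ} {z : V} (hd : DifferentiableAt ℝ ψ z)
    (hreal : ∀ᶠ w in 𝓝 z, (ψ w).im = 0) (h0 : ψ z ≠ 0) :
    HasFDerivAt (fun w => Complex.log (ψ w)) ((ψ z)⁻¹ • fderiv ℝ ψ z) z := by
  have main : ∀ φ : V → ℂ, DifferentiableAt ℝ φ z → φ z ∈ slitPlane →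
      HasFDerivAt (fun w => Complex.log (φ w)) ((φ z)⁻¹ • fderiv ℝ φ z) z := by
    intro φ hφ hs
    have h1 := ((Complex.hasDerivAt_log hs).hasFDerivAt.restrictScalars ℝ).comp z hφ.hasFDerivAt
    refine h1.congr_fderiv ?_
    ext v
    simp [mul_comm]
  by_cases hs : ψ z ∈ slitPlane
  · exact main ψ hd hs
  · have him := hreal.self_of_nhds
    have hre : (ψ z).re < 0 := by
      by_contra! h
      apply hs
      left
      refine lt_of_le_of_ne h fun h' => h0 ?_
      exact Complex.ext h'.symm him
    have hneg : ∀ᶠ w in 𝓝 z, (ψ w).re < 0 :=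
      (Complex.continuous_re.continuousAt.comp hd.continuousAt).eventually_lt
        continuousAt_const hre
    have e : (fun w => Complex.log (ψ w)) =ᶠ[𝓝 z]
        fun w => Complex.log (- ψ w) + Real.pi * I := by
      filter_upwards [hneg, hreal] with w h1 h2
      have h3 : ψ w = ((ψ w).re : ℂ) := Complex.ext rfl (by simpa using h2)
      apply Complex.ext
      · simp [Complex.log_re]
      · rw [h3, ← Complex.ofReal_neg, Complex.log_im, Complex.arg_ofReal_of_neg h1,
          Complex.add_im, Complex.log_im, Complex.arg_ofReal_of_nonneg (by linarith)]
        simp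
    have h4 := main (fun w => - ψ w) hd.neg (by left; simpa using hre)
    have h5 := (h4.add_const (Real.pi * I : ℂ)).congr_of_eventuallyEq e
    refine h5.congr_fderiv ?_
    rw [fderiv_fun_neg]
    ext v
    simp [inv_neg]

lemma krs_log_dir {p : V} {r : ℕ} (γ : Fin r → ℝ) (Φ : V → ℂ) (hΦ : AnalyticAt ℝ Φ p)
    (ψ : Fin r → V → ℂ) (hψ : ∀ k, AnalyticAt ℝ (ψ k) p)
    (hreal : ∀ᶠ z in 𝓝 p, ∀ k, (ψ k z).im = 0)
    (hprod : ∀ᶠ z in 𝓝 p, Complex.exp (Φ z) = ∏ k, (ψ k z) ^ (γ k : ℂ)) :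
    ∃ h0 : ∀ k : {k // γ k ≠ 0}, ψ k p ≠ 0,
      ∀ v, krsDir v (krsG Φ hΦ) = ∑ k : {k // γ k ≠ 0}, algebraMap ℂ (krsRA p) (γ k) *
        (krsDir v (krsG (ψ k) (hψ k)) *
          krsG (fun z => (ψ k z)⁻¹) ((hψ k).fun_inv (h0 k))) := by
  have hne : ∀ᶠ z in 𝓝 p, ∀ k : {k // γ k ≠ 0}, ψ k z ≠ 0 := by
    filter_upwards [hprod] with z hz k hk
    apply Complex.exp_ne_zero (Φ z)
    rw [hz]
    refine Finset.prod_eq_zero (Finset.mem_univ k.1) ?_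
    rw [hk, Complex.zero_cpow]
    exact_mod_cast k.2
  refine ⟨hne.self_of_nhds, fun v => ?_⟩
  simp only [krsG_const, krsDir_G, krsG_mul, krsG_sum]
  rw [krsG_eq]
  have hlog : ∀ᶠ z in 𝓝 p, Complex.exp (Φ z) =
      Complex.exp (∑ k : {k // γ k ≠ 0}, (γ k : ℂ) * Complex.log (ψ k z)) := by
    filter_upwards [hprod, hne] with z h1 h2
    rw [h1, Complex.exp_sum]
    have h3 : ∏ k, (ψ k z) ^ (γ k : ℂ) =
        ∏ k ∈ Finset.univ.filter (fun k => γ k ≠ 0), (ψ k z) ^ (γ k : ℂ) := by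
      rw [Finset.prod_filter]
      refine Finset.prod_congr rfl fun k _ => ?_
      by_cases hk : γ k = 0
      · simp [hk]
      · simp [hk]
    rw [h3, ← Finset.prod_subtype_eq_prod_filter]
    simp only [Finset.subtype_univ]
    refine Finset.prod_congr rfl fun k _ => ?_
    rw [Complex.cpow_def_of_ne_zero (h2 k), mul_comm]
  filter_upwards [eventually_eventually_nhds.2 hlog, hne, eventually_eventually_nhds.2 hreal,
    krs_ev_diff hΦ, Filter.eventually_all.2 fun k => krs_ev_diff (hψ k)] with z h1 h2 h3 h4 h5
  have hL : HasFDerivAt (fun z => ∑ k : {k // γ k ≠ 0}, (γ k : ℂ) * Complex.log (ψ k z))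
      (∑ k : {k // γ k ≠ 0}, (γ k : ℂ) • ((ψ k z)⁻¹ • fderiv ℝ (ψ k) z)) z := by
    refine HasFDerivAt.fun_sum fun k _ => ?_
    exact (krs_log_fderiv (h5 k) (h3.mono fun w hw => hw k) (h2 k)).const_mul _
  have hX : HasFDerivAt (fun z => Complex.exp (Φ z)) (Complex.exp (Φ z) • fderiv ℝ Φ z) z :=
    h4.hasFDerivAt.cexp
  have hY := hL.cexp
  have h6 := hX.unique (hY.congr_of_eventuallyEq h1)
  have h7 := congrArg (fun L => L v) h6
  simp only [ContinuousLinearMap.smul_apply, smul_eq_mul] at h7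
  rw [← h1.self_of_nhds] at h7
  have h8 := mul_left_cancel₀ (Complex.exp_ne_zero _) h7
  rw [h8]
  rw [ContinuousLinearMap.sum_apply]
  refine Finset.sum_congr rfl fun k _ => ?_
  simp only [ContinuousLinearMap.smul_apply, smul_eq_mul]
  ring

end An12


section Fin13
open Filter Topology

set_option maxHeartbeats 1000000 in
lemma krs_lie_zero {n : ℕ}
    (U : Set (Fin n → ℂ)) (hU : IsOpen U) (hUsymm : ∀ z ∈ U, conjVec z ∈ U)
    (g : (Fin n → ℂ) → Matrix (Fin n) (Fin n) ℂ) (hg : KahlerMetricOn U g)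
    (P : (Fin n → ℂ) × (Fin n → ℂ) → ℂ)
    (hP : AnalyticOn ℂ P (U ×ˢ (conjVec '' U)))
    (hPmetric : ∀ z ∈ U, ∀ α β : Fin n, g z α β = mixedDeriv P α β (z, conjVec z))
    (r : ℕ) (γ : Fin r → ℝ)
    (ψ : Fin r → ((Fin n → ℂ) × (Fin n → ℂ) → ℂ))
    (hψ : ∀ k, InCalabiF U (ψ k))
    (hprod : ∀ z ∈ U, Complex.exp (P (z, conjVec z))
        = ∏ k, (ψ k (z, conjVec z)) ^ ((γ k : ℂ)))
    (f : (Fin n → ℂ) → (Fin n → ℂ)) (hf : AnalyticOn ℂ f U)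
    (lam : ℝ)
    (hKRS : ∀ z ∈ U, ∀ α β : Fin n,
      ricci g α β z = (lam : ℂ) * g z α β + lieDerivMetric g f α β z)
    (p : Fin n → ℂ) (hp : p ∈ U) (α β : Fin n) : lieDerivMetric g f α β p = 0 := by
  have hUU : conjVec '' U = U := by
    ext z
    constructor
    · rintro ⟨w, hw, rfl⟩
      exact hUsymm w hw
    · intro hz
      exact ⟨conjVec z, hUsymm z hz, krs_conjVec_conjVec z⟩
  rw [hUU, (hU.prod hU).analyticOn_iff_analyticOnNhd] at hP
  rw [hU.analyticOn_iff_analyticOnNhd] at hf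
  have hPz : ∀ z ∈ U, AnalyticAt ℂ P (z, conjVec z) := fun z hz => hP _ ⟨hz, hUsymm z hz⟩
  have hUp := hU.mem_nhds hp
  let Φ : (Fin n → ℂ) → ℂ := fun z => P (z, conjVec z)
  have hΦ : AnalyticAt ℝ Φ p :=
    AnalyticAt.comp (g := P) (f := fun z => (z, conjVec z)) (x := p)
      ((hPz p hp).restrictScalars (𝕜 := ℝ)) (krs_an_conjVec p)
  have hgw : ∀ z ∈ U, ∀ a b, g z a b = wirt a (wirtBar b Φ) z := fun z hz a b => by
    rw [hPmetric z hz, krs_mixed (hPz z hz)]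
  have hgev : ∀ a b, wirt a (wirtBar b Φ) =ᶠ[𝓝 p] fun z => g z a b := fun a b => by
    filter_upwards [hUp] with z hz using (hgw z hz a b).symm
  have hga : ∀ a b, AnalyticAt ℝ (fun z => g z a b) p := fun a b =>
    (krs_an_wirt a (krs_an_wirtBar b hΦ)).congr (hgev a b)
  have hgG : ∀ a b, krsDD a (krsDB b (krsG Φ hΦ)) = krsG (fun z => g z a b) (hga a b) := by
    intro a b
    rw [krsDB_G, krsDD_G, krsG_eq]
    exact hgev a b
  have hdet : AnalyticAt ℝ (fun z => (g z).det) p := by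
    simp only [Matrix.det_apply']
    exact Finset.analyticAt_fun_sum _ fun s _ => analyticAt_const.mul
      (Finset.analyticAt_fun_prod _ fun i _ => hga _ _)
  have hdetpos : ∀ z ∈ U, 0 < (g z).det := fun z hz => (hg.2.1 z hz).det_pos
  have hdet0 : ∀ z ∈ U, (g z).det ≠ 0 := fun z hz => (hdetpos z hz).ne'
  have hdetG : krsG (fun z => (g z).det) hdet =
      Matrix.det (Matrix.of fun a b => krsDD a (krsDB b (krsG Φ hΦ))) := by
    rw [Matrix.det_apply']
    have hintcast : ∀ m : ℤ, (m : krsRA p) = krsG (fun _ => (m : ℂ)) analyticAt_const := fun m => by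
      rw [← krsG_const, map_intCast]
    simp only [Matrix.of_apply, hgG, hintcast, krsG_prod, krsG_mul, krsG_sum]
    rw [krsG_eq]
    exact Eventually.of_forall fun z => Matrix.det_apply' _
  have hfj : ∀ j, AnalyticAt ℂ (fun z => f z j) p := fun j =>
    ((ContinuousLinearMap.proj (R := ℂ) (φ := fun _ : Fin n => ℂ) j).analyticAt _).comp (hf p hp)
  let F : Fin n → krsRA p := fun j => krsG (fun z => f z j) (hfj j).restrictScalars
  let Fb : Fin n → krsRA p := fun j => krsG (fun z => starRingEnd ℂ (f z j))
    (krs_an_conj (hfj j).restrictScalars)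
  have hFb : ∀ j, krsDB β (Fb j) = krsG (fun z => starRingEnd ℂ (wirt β (fun w => f w j) z))
      (krs_an_conj (krs_an_wirt β (hfj j).restrictScalars)) := fun j => by
    rw [krsDB_G, krsG_eq]
    filter_upwards [(hfj j).eventually_analyticAt] with z hz
    exact krs_wirtBar_conj (hz.differentiableAt.restrictScalars ℝ) β
  have hLG : ∃ hL : AnalyticAt ℝ (fun z => lieDerivMetric g f α β z) p,
      ∑ j, (F j * krsDD j (krsDD α (krsDB β (krsG Φ hΦ)))
        + Fb j * krsDB j (krsDD α (krsDB β (krsG Φ hΦ)))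
        + krsDD α (F j) * krsDD j (krsDB β (krsG Φ hΦ))
        + krsDB β (Fb j) * krsDD α (krsDB j (krsG Φ hΦ))) = krsG _ hL := by
    simp only [hgG, hFb]
    simp only [F, Fb, krsDD_G, krsDB_G, krsG_mul, krsG_add, krsG_sum]
    exact ⟨Finset.analyticAt_fun_sum _ fun j _ =>
      ((((hfj j).restrictScalars.mul (krs_an_wirt j (hga α β))).add
        ((krs_an_conj (hfj j).restrictScalars).mul (krs_an_wirtBar j (hga α β)))).add
        ((krs_an_wirt α (hfj j).restrictScalars).mul (hga j β))).add
        ((krs_an_conj (krs_an_wirt β (hfj j).restrictScalars)).mul (hga α j)), rfl⟩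
  obtain ⟨hL, hLG⟩ := hLG
  choose hψa hψE using fun k => krs_calabi U hU hUsymm (ψ k) (hψ k) p hp
  obtain ⟨h0, hdir⟩ := krs_log_dir γ Φ hΦ (fun k z => ψ k (z, conjVec z)) hψa
    (by
      filter_upwards [hUp] with z hz k
      obtain ⟨m, S, ξ, f, -, -, -, -, -, h⟩ := hψ k
      exact h z hz)
    (by filter_upwards [hUp] with z hz using hprod z hz)
  have key := krs_abs_final (fun k => krsDD k) (fun k => krsDB k) (krsEv p) krs_comm1 krs_comm2
    krs_comm3 (krsG Φ hΦ) {k // γ k ≠ 0}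
    (fun k => krsG (fun z => ψ k (z, conjVec z)) (hψa k))
    (fun k => krsG (fun z => (ψ k (z, conjVec z))⁻¹) ((hψa k).fun_inv (h0 k)))
    (fun k => krsG_inv (hψa k) (h0 k)) (fun k => (γ k : ℂ))
    (fun j => by
      simp only [krsDD_apply]
      rw [hdir, hdir, Finset.smul_sum, ← Finset.sum_sub_distrib, Finset.smul_sum]
      refine Finset.sum_congr rfl fun k _ => ?_
      rw [smul_mul_assoc, mul_smul_comm, sub_mul, mul_sub, smul_mul_assoc, mul_smul_comm])
    (fun j => by
      simp only [krsDB_apply]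
      rw [hdir, hdir, Finset.smul_sum, ← Finset.sum_add_distrib, Finset.smul_sum]
      refine Finset.sum_congr rfl fun k _ => ?_
      rw [smul_mul_assoc, mul_smul_comm, add_mul, mul_add, smul_mul_assoc, mul_smul_comm])
    F Fb (fun l j => krsDB_hol (hfj j) l) (fun l j => krsDD_anti (hfj j) l) α β
    (fun E hE i => hψE i α β E hE)
    (krsG (fun z => (g z).det) hdet) (krsG (fun z => ((g z).det)⁻¹) (hdet.fun_inv (hdet0 p hp)))
    hdetG (krsG_inv hdet (hdet0 p hp)) lam
    (by
      rw [hLG, hgG, krsDB_G, krsG_mul, krsDD_G, krsG_neg, krsG_const, krsG_mul, krsG_add, krsG_eq]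
      filter_upwards [hUp, eventually_eventually_nhds.2 hUp,
        hdet.eventually_analyticAt.eventually_nhds] with z hz hz2 hz3
      rw [← hKRS z hz, ricci]
      congr 1
      have e : (fun w => wirtBar β (fun u => Complex.log ((g u).det)) w) =ᶠ[𝓝 z]
          fun w => wirtBar β (fun u => (g u).det) w * ((g w).det)⁻¹ := by
        filter_upwards [hz2, hz3] with w hw hw3
        have hlog := (krs_log_fderiv hw3.differentiableAt (by
          filter_upwards [hU.mem_nhds hw] with u hu
          have := (Complex.lt_def.1 (hdetpos u hu)).2
          simpa using this.symm) (hdet0 w hw)).fderiv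
        rw [wirtBar, wirtBar, hlog]
        simp only [ContinuousLinearMap.smul_apply, smul_eq_mul]
        ring
      rw [wirt, wirt, e.fderiv_eq])
  have key2 : krsEv p (krsG _ hL) = 0 := by
    rw [← hLG]
    exact key
  exact key2

end Fin13

/-- If the diastasis `D^g_p` of `(M, g)` at `p` (here `p = 0`, with polarization `P`)
satisfies `e^{D^g_p} ∈ F̃^{γ₁} ⋯ F̃^{γ_r}`, i.e. `e^{D^g_p}` is a product of real
powers of diastasis-type functions built from Nash algebraic data, then every
Kähler–Ricci soliton `(g, X)` on `M` is trivial: `g` is Kähler–Einstein. -/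
theorem KRS_trivial_of_exp_diastasis_in_Ftilde {n : ℕ}
    (U : Set (Fin n → ℂ)) (hU : IsOpen U) (h0 : (0 : Fin n → ℂ) ∈ U)
    (hUconn : IsConnected U) (hUsymm : ∀ z ∈ U, conjVec z ∈ U)
    (g : (Fin n → ℂ) → Matrix (Fin n) (Fin n) ℂ) (hg : KahlerMetricOn U g)
    (P : (Fin n → ℂ) × (Fin n → ℂ) → ℂ)
    (hP : AnalyticOn ℂ P (U ×ˢ (conjVec '' U)))
    (hPreal : ∀ z ∈ U, (P (z, conjVec z)).im = 0)
    (hPdia : DiastasisTypeF U P)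
    (hPmetric : ∀ z ∈ U, ∀ α β : Fin n, g z α β = mixedDeriv P α β (z, conjVec z))
    (r : ℕ) (γ : Fin r → ℝ)
    (hprod : ∃ ψ : Fin r → ((Fin n → ℂ) × (Fin n → ℂ) → ℂ),
      (∀ k, InCalabiF U (ψ k)) ∧ (∀ k, DiastasisTypeF U (ψ k)) ∧
      ∀ z ∈ U, Complex.exp (P (z, conjVec z))
        = ∏ k, (ψ k (z, conjVec z)) ^ ((γ k : ℂ)))
    (f : (Fin n → ℂ) → (Fin n → ℂ)) (hf : AnalyticOn ℂ f U)
    (lam : ℝ)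
    (hKRS : ∀ z ∈ U, ∀ α β : Fin n,
      ricci g α β z = (lam : ℂ) * g z α β + lieDerivMetric g f α β z) :
    ∃ c : ℝ, ∀ z ∈ U, ∀ α β : Fin n, ricci g α β z = (c : ℂ) * g z α β := by
  obtain ⟨ψ, hψ, -, hprod⟩ := hprod
  refine ⟨lam, fun z hz α β => ?_⟩
  rw [hKRS z hz, krs_lie_zero U hU hUsymm g hg P hP hPmetric r γ ψ hψ hprod f hf lam hKRS z hz,
    add_zero]
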